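/- arXiv:2201.01023 — 4 statements merged into one kernel-verified Lean document; each statement's English description precedes it below -/
import Mathlib

section
/- Let (R,m,k) be a commutative Noetherian local ring, let M and X be finitely generated R-modules with X faithful (i.e., Ann_R(X) = 0), and let N be a weakly m-full submodule of X, i.e., (mN :_X m) = N. Assume N ⊆ mX and X/N has finite length. If t ≥ 0 is an integer such that Tor_t^R(M, N) = 0, then the projective dimension of M is at most t. -/
open CategoryTheory

universe u

/-- The colon submodule `(N :_X I) = {x ∈ X : I • x ⊆ N}`. -/
def Submodule.colonBy {R X : Type u} [CommRing R] [AddCommGroup X] [Module R X]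
    (N : Submodule R X) (I : Ideal R) : Submodule R X where
  carrier := {x | ∀ r ∈ I, r • x ∈ N}
  add_mem' := by
    intro a b ha hb r hr
    rw [smul_add]
    exact N.add_mem (ha r hr) (hb r hr)
  zero_mem' := by
    intro r hr
    rw [smul_zero]
    exact N.zero_mem
  smul_mem' := by
    intro c x hx r hr
    rw [smul_comm]
    exact N.smul_mem c (hx r hr)

/-- A submodule `N` of a module `X` over a local ring `(R, 𝔪)` is *Burch* if
`𝔪 • (N :_X 𝔪) ≠ 𝔪 • N`. -/
def Submodule.IsBurch {R X : Type u} [CommRing R] [IsLocalRing R] [AddCommGroup X]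
    [Module R X] (N : Submodule R X) : Prop :=
  IsLocalRing.maximalIdeal R • N.colonBy (IsLocalRing.maximalIdeal R) ≠
    IsLocalRing.maximalIdeal R • N

/-- `Tor_n^R(M, N) = 0`. -/
def TorIsZero (R : Type u) [CommRing R] (M N : Type u) [AddCommGroup M] [Module R M]
    [AddCommGroup N] [Module R N] (n : ℕ) : Prop :=
  Subsingleton (((Tor (ModuleCat.{u} R) n).obj (ModuleCat.of R M)).obj (ModuleCat.of R N))

/-- `Ext^n_R(M, N) = 0`. -/
def ExtIsZero (R : Type u) [CommRing R] (M N : Type u) [AddCommGroup M] [Module R M]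
    [AddCommGroup N] [Module R N] (n : ℕ) : Prop :=
  Subsingleton
    (((Ext R (ModuleCat.{u} R) n).obj (Opposite.op (ModuleCat.of R M))).obj (ModuleCat.of R N))

/-- `M` has projective dimension strictly less than `t`, i.e. `M` admits a projective
resolution vanishing in all degrees `≥ t`. -/
def HasProjDimLT (R : Type u) [CommRing R] (M : Type u) [AddCommGroup M] [Module R M]
    (t : ℕ) : Prop :=
  ∃ P : ProjectiveResolution (ModuleCat.of R M), ∀ i, t ≤ i → Limits.IsZero (P.complex.X i)

/-- `M` has injective dimension strictly less than `t`, i.e. `M` admits an injective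
resolution vanishing in all degrees `≥ t`. -/
def HasInjDimLT (R : Type u) [CommRing R] (M : Type u) [AddCommGroup M] [Module R M]
    (t : ℕ) : Prop :=
  ∃ I : InjectiveResolution (ModuleCat.of R M), ∀ i, t ≤ i → Limits.IsZero (I.cocomplex.X i)

/-- The depth of a module `M` over a local ring `(R, 𝔪, k)`: the smallest `i` such that
`Ext^i_R(k, M) ≠ 0` (and `⊤` if no such `i` exists). -/
noncomputable def moduleDepth (R : Type u) [CommRing R] [IsLocalRing R] (M : Type u)
    [AddCommGroup M] [Module R M] : ℕ∞ :=
  sInf {n : ℕ∞ | ∃ i : ℕ, n = (i : ℕ∞) ∧ ¬ ExtIsZero R (IsLocalRing.ResidueField R) M i}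

open CategoryTheory Limits MonoidalCategory TensorProduct IsLocalRing

section MinimalGenerators

variable {R : Type*} [CommRing R] [IsLocalRing R]

theorem exists_minimal_generators (S : Type*) [AddCommGroup S] [Module R S] [Module.Finite R S] :
    ∃ (n : ℕ) (v : Fin n → S), Submodule.span R (Set.range v) = ⊤ ∧
      ∀ c : Fin n → R, ∑ i, c i • v i = 0 → ∀ i, c i ∈ maximalIdeal R := by
  let b := Module.finBasis (ResidueField R) (ResidueField R ⊗[R] S)
  choose v hv using fun i ↦ TensorProduct.mk_surjective R S (ResidueField R)
    Ideal.Quotient.mk_surjective (b i)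
  refine ⟨_, v, span_eq_top_of_tmul_eq_basis v b hv, fun c hc i ↦ ?_⟩
  rw [← residue_eq_zero_iff]
  refine Fintype.linearIndependent_iff.1 b.linearIndependent (fun i ↦ residue R (c i)) ?_ i
  have := congrArg (TensorProduct.mk R (ResidueField R) S 1) hc
  rw [map_sum, map_zero] at this
  rw [← this]
  refine Finset.sum_congr rfl fun j _ ↦ ?_
  rw [map_smul, hv]
  exact algebraMap_smul _ (c j) (b j)

theorem exists_maximalIdeal_pow_smul_top_eq_bot (Q : Type*) [AddCommGroup Q]
    [Module R Q] (h : IsFiniteLength R Q) : ∃ n : ℕ, maximalIdeal R ^ n • (⊤ : Submodule R Q) = ⊥ := by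
  obtain ⟨_, _⟩ := isFiniteLength_iff_isNoetherian_isArtinian.1 h
  obtain ⟨n, hn⟩ := IsArtinian.monotone_stabilizes
    ⟨fun n ↦ OrderDual.toDual (maximalIdeal R ^ n • (⊤ : Submodule R Q)),
      fun a b hab ↦ Submodule.smul_mono_left (Ideal.pow_le_pow_right hab)⟩
  refine ⟨n, Submodule.eq_bot_of_le_smul_of_le_jacobson_bot (maximalIdeal R) _
    (IsNoetherian.noetherian _) ?_ (IsLocalRing.maximalIdeal_le_jacobson _)⟩
  have := hn (n + 1) (Nat.le_succ n)
  rw [← Submodule.mul_smul, ← pow_succ']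
  exact le_of_eq (congrArg OrderDual.ofDual this)

variable {X : Type*} [AddCommGroup X] [Module R X]

/-- Let `N` be a weakly `𝔪`-full submodule of a finite faithful module `X`, contained in `𝔪X` and
of finite colength. A finite module `S` for which `S ⊗ N → S ⊗ X` is injective is free. -/
theorem free_of_lTensor_subtype_injective [IsNoetherianRing R] [Module.Finite R X]
    (hfaith : Module.annihilator R X = ⊥) (N : Submodule R X)
    (hwmf : ∀ x : X, (∀ r ∈ maximalIdeal R, r • x ∈ maximalIdeal R • N) → x ∈ N)
    (hsub : N ≤ maximalIdeal R • (⊤ : Submodule R X)) (hlen : IsFiniteLength R (X ⧸ N))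
    (S : Type*) [AddCommGroup S] [Module R S] [Module.Finite R S]
    (hS : Function.Injective (N.subtype.lTensor S)) : Module.Free R S := by
  obtain ⟨n, v, hv, hmin⟩ := exists_minimal_generators (R := R) S
  have key : ∀ (c : Fin n → R) (x : X), ∑ i, c i • v i = 0 → (∀ i, c i • x ∈ N) →
      ∃ (k : ℕ) (a : Fin n → Fin k → R) (y : Fin k → N),
        (∀ j, ∑ i, a i j • v i = 0) ∧ ∀ i, c i • x = ∑ j, a i j • (y j : X) := by
    intro c x hc hx
    have h0 : ∑ i, v i ⊗ₜ[R] (⟨c i • x, hx i⟩ : N) = 0 := by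
      apply hS
      simp only [map_sum, LinearMap.lTensor_tmul, Submodule.subtype_apply, map_zero,
        ← TensorProduct.smul_tmul, ← TensorProduct.sum_tmul, hc, TensorProduct.zero_tmul]
    obtain ⟨k, a, y, h1, h2⟩ := vanishesTrivially_of_sum_tmul_eq_zero R hv h0
    exact ⟨k, a, y, h2, fun i ↦ by simpa using congrArg Subtype.val (h1 i)⟩
  have hmN : ∀ (c : Fin n → R) (x : X), ∑ i, c i • v i = 0 → (∀ i, c i • x ∈ N) →
      ∀ i, c i • x ∈ maximalIdeal R • N := by
    intro c x hc hx i
    obtain ⟨k, a, y, h1, h2⟩ := key c x hc hx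
    rw [h2]
    exact Submodule.sum_mem _ fun j _ ↦
      Submodule.smul_mem_smul (hmin _ (h1 j) i) (y j).2
  have hpow : ∀ (j : ℕ) (x : X), (∀ r ∈ maximalIdeal R ^ j, r • x ∈ N) →
      ∀ c : Fin n → R, ∑ i, c i • v i = 0 → ∀ i, c i • x ∈ N := by
    intro j
    induction j with
    | zero =>
      intro x hx c _ i
      exact N.smul_mem _ (by simpa using hx 1 (by simp))
    | succ j ih =>
      intro x hx c hc i
      refine hwmf _ fun r hr ↦ ?_
      rw [smul_comm]
      refine hmN c _ hc (ih _ (fun s hs ↦ ?_) c hc) i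
      rw [← mul_smul]
      exact hx _ (pow_succ (maximalIdeal R) j ▸ Ideal.mul_mem_mul hs hr)
  obtain ⟨l, hl⟩ := exists_maximalIdeal_pow_smul_top_eq_bot (R := R) _ hlen
  have hN : ∀ (c : Fin n → R) (x : X), ∑ i, c i • v i = 0 → ∀ i, c i • x ∈ N := by
    intro c x hc
    refine hpow l x (fun r hr ↦ ?_) c hc
    have : r • N.mkQ x ∈ maximalIdeal R ^ l • (⊤ : Submodule R (X ⧸ N)) :=
      Submodule.smul_mem_smul hr trivial
    rw [hl, Submodule.mem_bot, ← map_smul] at this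
    rwa [Submodule.mkQ_apply, Submodule.Quotient.mk_eq_zero] at this
  let D : Submodule R (Fin n → X) := Submodule.span R
    {w | ∃ (c : Fin n → R) (x : X), ∑ i, c i • v i = 0 ∧ w = fun i ↦ c i • x}
  have hD : D = ⊥ := by
    refine Submodule.eq_bot_of_le_smul_of_le_jacobson_bot (maximalIdeal R) D
      (IsNoetherian.noetherian _) ?_ (IsLocalRing.maximalIdeal_le_jacobson _)
    refine Submodule.span_le.2 ?_
    rintro _ ⟨c, x, hc, rfl⟩
    obtain ⟨k, a, y, h1, h2⟩ := key c x hc (hN c x hc)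
    have : (fun i ↦ c i • x) = ∑ j, fun i ↦ a i j • (y j : X) := by
      ext i
      simp [h2]
    rw [this]
    refine Submodule.sum_mem _ fun j _ ↦ ?_
    refine Submodule.smul_induction_on (p := fun z ↦ (fun i ↦ a i j • z) ∈ maximalIdeal R • D)
      (hsub (y j).2) (fun r hr z _ ↦ ?_) (fun z z' hz hz' ↦ ?_)
    · have : (fun i ↦ a i j • r • z) = r • fun i ↦ a i j • z := by
        ext i
        simp [smul_comm r]
      rw [this]
      exact Submodule.smul_mem_smul hr (Submodule.subset_span ⟨_, z, h1 j, rfl⟩)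
    · simp only [smul_add]
      exact Submodule.add_mem _ hz hz'
  have hli : LinearIndependent R v := by
    refine Fintype.linearIndependent_iff.2 fun c hc i ↦ ?_
    rw [← Submodule.mem_bot R, ← hfaith, Module.mem_annihilator]
    intro x
    have : (fun i ↦ c i • x) ∈ D := Submodule.subset_span ⟨c, x, hc, rfl⟩
    rw [hD, Submodule.mem_bot] at this
    exact congrFun this i
  exact .of_basis (.mk hli hv.ge)

end MinimalGenerators

section Splice

universe v w

variable {C : Type w} [Category.{v} C] [Abelian C]

namespace CategoryTheory.ProjectiveResolution

/-- The augmentation map of a projective resolution, with target the resolved object. -/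
noncomputable def augmentation {Z : C} (P : ProjectiveResolution Z) : P.complex.X 0 ⟶ Z :=
  P.π.f 0

lemma epi_augmentation {Z : C} (P : ProjectiveResolution Z) : Epi P.augmentation :=
  inferInstanceAs (Epi (P.π.f 0))

lemma d_comp_augmentation {Z : C} (P : ProjectiveResolution Z) :
    P.complex.d 1 0 ≫ P.augmentation = 0 :=
  P.complex_d_comp_π_f_zero

lemma exact_augmentation {Z : C} (P : ProjectiveResolution Z) :
    (ShortComplex.mk _ _ P.d_comp_augmentation).Exact :=
  P.exact₀

lemma d_comp_augmentation_comp {Z W : C} (P : ProjectiveResolution Z) (f : Z ⟶ W) :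
    P.complex.d 1 0 ≫ P.augmentation ≫ f = 0 := by
  rw [← Category.assoc, P.d_comp_augmentation, zero_comp]

variable {T : ShortComplex C} (P : ProjectiveResolution T.X₁)

/-- The complex obtained from a projective resolution of the kernel in a short exact sequence by
appending the middle term. -/
noncomputable abbrev spliceComplex : ChainComplex C ℕ :=
  P.complex.augment (P.augmentation ≫ T.f) (P.d_comp_augmentation_comp T.f)

lemma spliceComplex_exactAt_succ (hT : T.ShortExact) (n : ℕ) : (spliceComplex P).ExactAt (n + 1) := by
  rw [HomologicalComplex.exactAt_iff' _ (n + 2) (n + 1) n (by simp) (by simp)]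
  cases n with
  | zero =>
    let φ : ShortComplex.mk _ _ P.d_comp_augmentation ⟶
        ShortComplex.mk _ _ (P.d_comp_augmentation_comp T.f) :=
      { τ₁ := 𝟙 _, τ₂ := 𝟙 _, τ₃ := T.f }
    have : Epi φ.τ₁ := inferInstanceAs (Epi (𝟙 _))
    have : IsIso φ.τ₂ := inferInstanceAs (IsIso (𝟙 _))
    have : Mono φ.τ₃ := hT.mono_f
    exact (ShortComplex.exact_iff_of_epi_of_isIso_of_mono φ).1 P.exact_augmentation
  | succ n => exact P.exact_succ n

/-- Splicing a projective resolution of the kernel in a short exact sequence with projective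
middle term yields a projective resolution of the cokernel. -/
noncomputable def splice (hT : T.ShortExact) [Projective T.X₂] : ProjectiveResolution T.X₃ where
  complex := spliceComplex P
  projective := by
    rintro (_ | n)
    · assumption
    · exact P.projective n
  π := (ChainComplex.toSingle₀Equiv _ _).symm ⟨T.g, by
    change (P.augmentation ≫ T.f) ≫ T.g = 0
    rw [Category.assoc, T.zero, comp_zero]⟩
  quasiIso := ⟨fun n => by
    cases n
    · rw [ChainComplex.quasiIsoAt₀_iff, ShortComplex.quasiIso_iff_of_zeros']
      · let S : ShortComplex C := ShortComplex.mk (P.augmentation ≫ T.f) T.g (by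
          rw [Category.assoc, T.zero, comp_zero])
        have h : S.Exact ∧ Epi S.g := by
          refine ⟨?_, hT.epi_g⟩
          let φ : S ⟶ T := { τ₁ := P.augmentation, τ₂ := 𝟙 _, τ₃ := 𝟙 _ }
          have : Epi φ.τ₁ := P.epi_augmentation
          have : IsIso φ.τ₂ := inferInstanceAs (IsIso (𝟙 _))
          have : Mono φ.τ₃ := inferInstanceAs (Mono (𝟙 _))
          exact (ShortComplex.exact_iff_of_epi_of_isIso_of_mono φ).2 hT.exact
        refine (ShortComplex.exact_and_epi_g_iff_of_iso ?_).2 h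
        refine ShortComplex.isoMk (Iso.refl _) (Iso.refl _) (Iso.refl _)
          ((Category.id_comp _).trans (Category.comp_id _).symm)
          ((Category.id_comp _).trans (Eq.trans ?_ (Category.comp_id _).symm))
        exact (ChainComplex.toSingle₀Equiv_symm_apply_f_zero (C := spliceComplex P) T.g _).symm
      all_goals rfl
    · rw [quasiIsoAt_iff_exactAt']
      · exact spliceComplex_exactAt_succ P hT _
      · apply ChainComplex.exactAt_succ_single_obj⟩

end CategoryTheory.ProjectiveResolution

end Splice

section Tor

variable {R : Type u} [CommRing R]

/-- The chain complex `A ⊗ K`. -/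
noncomputable abbrev tensorComplex (K : ChainComplex (ModuleCat.{u} R) ℕ) (A : ModuleCat.{u} R) :
    ChainComplex (ModuleCat.{u} R) ℕ :=
  (((tensoringLeft (ModuleCat.{u} R)).obj A).mapHomologicalComplex _).obj K

/-- The chain map `A ⊗ K ⟶ B ⊗ K` induced by `f : A ⟶ B`. -/
noncomputable abbrev tensorComplexMap (K : ChainComplex (ModuleCat.{u} R) ℕ) {A B : ModuleCat.{u} R}
    (f : A ⟶ B) : tensorComplex K A ⟶ tensorComplex K B :=
  (NatTrans.mapHomologicalComplex ((tensoringLeft (ModuleCat.{u} R)).map f) _).app K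

/-- The short complex of chain complexes `T ⊗ K`. -/
noncomputable def tensorShortComplex (K : ChainComplex (ModuleCat.{u} R) ℕ)
    (T : ShortComplex (ModuleCat.{u} R)) : ShortComplex (ChainComplex (ModuleCat.{u} R) ℕ) :=
  ShortComplex.mk (tensorComplexMap K T.f) (tensorComplexMap K T.g) (by
    ext i : 1
    change (T.f ▷ K.X i) ≫ (T.g ▷ K.X i) = 0
    rw [← comp_whiskerRight, T.zero, MonoidalPreadditive.zero_whiskerRight])

lemma tensorShortComplex_shortExact (K : ChainComplex (ModuleCat.{u} R) ℕ)
    [∀ i, Module.Flat R (K.X i)] {T : ShortComplex (ModuleCat.{u} R)} (hT : T.ShortExact) :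
    (tensorShortComplex K T).ShortExact := by
  refine HomologicalComplex.shortExact_of_degreewise_shortExact _ fun i ↦ ?_
  exact hT.map_of_exact (tensorRight (K.X i))

lemma tensorComplex_exactAt_succ {N : ModuleCat.{u} R} (P : ProjectiveResolution N)
    (A : ModuleCat.{u} R) [Module.Flat R A] (n : ℕ) :
    (tensorComplex P.complex A).ExactAt (n + 1) := by
  rw [HomologicalComplex.exactAt_iff' _ (n + 2) (n + 1) n (by simp) (by simp)]
  have h := P.exact_succ n
  rw [ShortComplex.ShortExact.moduleCat_exact_iff_function_exact] at h ⊢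
  exact Module.Flat.lTensor_exact A h

instance {N : ModuleCat.{u} R} (P : ProjectiveResolution N) (i : ℕ) :
    Module.Flat R (P.complex.X i) := by
  have : Module.Projective R (P.complex.X i) :=
    (IsProjective.iff_projective _).2 (P.projective i)
  infer_instance

lemma isZero_tor_iff_tensorComplex {N : ModuleCat.{u} R} (P : ProjectiveResolution N)
    (A : ModuleCat.{u} R) (n : ℕ) :
    IsZero (((Tor (ModuleCat.{u} R) n).obj A).obj N) ↔
      IsZero ((tensorComplex P.complex A).homology n) :=
  (P.isoLeftDerivedObj ((tensoringLeft (ModuleCat.{u} R)).obj A) n).isZero_iff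

lemma isZero_tor_of_shortExact {T : ShortComplex (ModuleCat.{u} R)} (hT : T.ShortExact)
    [Module.Flat R T.X₂] (N : ModuleCat.{u} R) (n : ℕ)
    (h : IsZero (((Tor (ModuleCat.{u} R) (n + 2)).obj T.X₃).obj N)) :
    IsZero (((Tor (ModuleCat.{u} R) (n + 1)).obj T.X₁).obj N) := by
  let P := projectiveResolution N
  have hS := tensorShortComplex_shortExact P.complex hT
  rw [isZero_tor_iff_tensorComplex P] at h ⊢
  exact h.of_iso (hS.δIso (n + 2) (n + 1) (by simp)
    (tensorComplex_exactAt_succ P T.X₂ (n + 1)).isZero_homology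
    (tensorComplex_exactAt_succ P T.X₂ n).isZero_homology).symm

lemma mono_whiskerRight_of_isZero_tor_one {T : ShortComplex (ModuleCat.{u} R)} (hT : T.ShortExact)
    (N : ModuleCat.{u} R)
    (h : IsZero (((Tor (ModuleCat.{u} R) 1).obj T.X₃).obj N)) :
    Mono (T.f ▷ N) := by
  let P := projectiveResolution N
  have hS := tensorShortComplex_shortExact P.complex hT
  rw [isZero_tor_iff_tensorComplex P] at h
  have hm : Mono (HomologicalComplex.homologyMap (tensorShortComplex P.complex T).f 0) :=
    (hS.homology_exact₁ 1 0 (by simp)).mono_g (h.eq_of_src _ _)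
  let e (A : ModuleCat.{u} R) : (tensorComplex P.complex A).homology 0 ≅ A ⊗ N :=
    ChainComplex.isoHomologyι₀ _ ≪≫
      asIso (P.fromLeftDerivedZero' ((tensoringLeft (ModuleCat.{u} R)).obj A))
  have hcomm : HomologicalComplex.homologyMap (tensorComplexMap P.complex T.f) 0 ≫ (e T.X₂).hom =
      (e T.X₁).hom ≫ (T.f ▷ N) := by
    simp only [e, Iso.trans_hom, asIso_hom]
    rw [HomologicalComplex.isoHomologyι_hom, HomologicalComplex.isoHomologyι_hom, HomologicalComplex.homologyι_naturality_assoc, Category.assoc]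
    congr 1
    rw [← cancel_epi (HomologicalComplex.pOpcycles _ _)]
    rw [HomologicalComplex.p_opcyclesMap_assoc,
      ProjectiveResolution.pOpcycles_comp_fromLeftDerivedZero',
      ProjectiveResolution.pOpcycles_comp_fromLeftDerivedZero'_assoc]
    exact (((tensoringLeft (ModuleCat.{u} R)).map T.f).naturality (P.π.f 0)).symm
  have : T.f ▷ N = (e T.X₁).inv ≫
      HomologicalComplex.homologyMap (tensorComplexMap P.complex T.f) 0 ≫ (e T.X₂).hom := by
    rw [hcomm, Iso.inv_hom_id_assoc]
  rw [this]
  have hm' : Mono (HomologicalComplex.homologyMap (tensorComplexMap P.complex T.f) 0) := hm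
  infer_instance

lemma hasProjDimLT_one_of_free (M : Type u) [AddCommGroup M] [Module R M] [Module.Free R M] :
    HasProjDimLT R M 1 := by
  have : Projective (ModuleCat.of R M) := (IsProjective.iff_projective _).1 inferInstance
  exact ⟨ProjectiveResolution.self _, fun i hi ↦
    HomologicalComplex.isZero_single_obj_X _ _ _ _ (Nat.one_le_iff_ne_zero.1 hi)⟩

lemma hasProjDimLT_succ_of_surjective {F M : Type u} [AddCommGroup F] [Module R F]
    [Module.Projective R F] [AddCommGroup M] [Module R M] {f : F →ₗ[R] M}
    (hf : Function.Surjective f) {n : ℕ} (h : HasProjDimLT R (LinearMap.ker f) n) :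
    HasProjDimLT R M (n + 1) := by
  obtain ⟨P, hP⟩ := h
  have : Projective f.shortComplexKer.X₂ := (IsProjective.iff_projective _).1 ‹_›
  refine ⟨ProjectiveResolution.splice P (LinearMap.shortExact_shortComplexKer hf), fun i hi ↦ ?_⟩
  obtain ⟨i, rfl⟩ := Nat.exists_eq_succ_of_ne_zero (Nat.ne_zero_of_lt hi)
  exact hP i (Nat.le_of_succ_le_succ hi)

lemma torIsZero_iff_isZero (M N : Type u) [AddCommGroup M] [Module R M]
    [AddCommGroup N] [Module R N] (n : ℕ) :
    TorIsZero R M N n ↔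
      IsZero (((Tor (ModuleCat.{u} R) n).obj (ModuleCat.of R M)).obj (ModuleCat.of R N)) :=
  ModuleCat.isZero_iff_subsingleton.symm

lemma subsingleton_tensorProduct_of_torIsZero_zero {M N : Type u} [AddCommGroup M] [Module R M]
    [AddCommGroup N] [Module R N] (h : TorIsZero R M N 0) : Subsingleton (M ⊗[R] N) := by
  rw [torIsZero_iff_isZero] at h
  have : PreservesFiniteColimits ((tensoringLeft (ModuleCat.{u} R)).obj (ModuleCat.of R M)) :=
    inferInstanceAs (PreservesFiniteColimits (tensorLeft (ModuleCat.of R M)))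
  exact ModuleCat.isZero_iff_subsingleton.1 (h.of_iso
    (((tensoringLeft (ModuleCat.{u} R)).obj (ModuleCat.of R M)).leftDerivedZeroIsoSelf.app
      (ModuleCat.of R N)).symm)

/-- Dimension shifting: if every finite module `S` with `S ⊗ N → S ⊗ X` injective is free, then
the vanishing of `Tor` in degree `t` bounds the projective dimension by `t`. -/
lemma hasProjDimLT_of_torIsZero [IsNoetherianRing R] {X : Type u} [AddCommGroup X] [Module R X]
    (N : Submodule R X)
    (hfree : ∀ (S : Type u) [AddCommGroup S] [Module R S] [Module.Finite R S],
      Function.Injective (N.subtype.lTensor S) → Module.Free R S)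
    (t : ℕ) (M : Type u) [AddCommGroup M] [Module R M] [Module.Finite R M]
    (h : TorIsZero R M N t) : HasProjDimLT R M (t + 1) := by
  induction t generalizing M with
  | zero =>
    have := subsingleton_tensorProduct_of_torIsZero_zero h
    have := hfree M (Function.injective_of_subsingleton _)
    exact hasProjDimLT_one_of_free M
  | succ t ih =>
    obtain ⟨n, f, hf⟩ := Module.Finite.exists_fin' R M
    rw [torIsZero_iff_isZero] at h
    have hT := LinearMap.shortExact_shortComplexKer hf
    refine hasProjDimLT_succ_of_surjective hf ?_
    cases t with
    | zero =>
      have hm := (ModuleCat.mono_iff_injective _).1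
        (mono_whiskerRight_of_isZero_tor_one hT (ModuleCat.of R N) h)
      have hinj : Function.Injective ((LinearMap.ker f).subtype.rTensor N) := hm
      have hcomp : Function.Injective
          ((LinearMap.ker f).subtype.rTensor X ∘ₗ N.subtype.lTensor (LinearMap.ker f)) := by
        rw [LinearMap.rTensor_comp_lTensor, ← LinearMap.lTensor_comp_rTensor]
        exact (Module.Flat.lTensor_preserves_injective_linearMap (M := Fin n → R) N.subtype
          N.injective_subtype).comp hinj
      have := hfree (LinearMap.ker f) (Function.Injective.of_comp hcomp)
      exact hasProjDimLT_one_of_free _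
    | succ t =>
      have : Module.Flat R f.shortComplexKer.X₂ := inferInstanceAs (Module.Flat R (Fin n → R))
      refine ih _ ?_
      rw [torIsZero_iff_isZero]
      exact isZero_tor_of_shortExact hT (ModuleCat.of R N) t h

end Tor

/-- Over a Noetherian local ring `(R, 𝔪)`, let `X` be finitely generated and
faithful, and let `N` be a weakly `𝔪`-full submodule of `X` (i.e. `(𝔪N :_X 𝔪) = N`) with
`N ⊆ 𝔪X` and `X/N` of finite length. If `M` is finitely generated, `t ≥ 0` and
`Tor_t^R(M, N) = 0`, then `pd_R M ≤ t`. -/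
theorem weakly_m_full_tor_vanishing
    {R : Type u} [CommRing R] [IsNoetherianRing R] [IsLocalRing R]
    {M : Type u} [AddCommGroup M] [Module R M] [Module.Finite R M]
    {X : Type u} [AddCommGroup X] [Module R X] [Module.Finite R X]
    (hfaith : Module.annihilator R X = ⊥)
    (N : Submodule R X)
    (hwmf : Submodule.colonBy (IsLocalRing.maximalIdeal R • N) (IsLocalRing.maximalIdeal R) = N)
    (hsub : N ≤ IsLocalRing.maximalIdeal R • (⊤ : Submodule R X))
    (hlen : IsFiniteLength R (X ⧸ N))
    (t : ℕ)
    (h : TorIsZero R M (↥N) t) :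
    HasProjDimLT R M (t + 1) := by
  refine hasProjDimLT_of_torIsZero N (fun S _ _ _ hS ↦ ?_) t M h
  exact free_of_lTensor_subtype_injective hfaith N (fun x hx ↦ hwmf.le hx) hsub hlen S hS
end

section
/- Let (R,m,k) be a commutative Noetherian local ring, let M and X be finitely generated R-modules with X faithful (i.e., Ann_R(X) = 0), and let N be a weakly m-full submodule of X, i.e., (mN :_X m) = N. Assume N ⊆ mX and X/N has finite length. If t ≥ 1 is an integer such that Tor_t^R(M, X/N) = 0, then the projective dimension of M is strictly less than t. -/
open CategoryTheory

universe u

open TensorProduct IsLocalRing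

/-- A finitely generated module over a local ring has a free cover whose kernel has entries in the
maximal ideal. -/
theorem IsLocalRing.exists_minimal_free_cover (R : Type*) [CommRing R] [IsLocalRing R]
    (M : Type*) [AddCommGroup M] [Module R M] [Module.Finite R M] :
    ∃ (n : ℕ) (f : (Fin n → R) →ₗ[R] M), Function.Surjective f ∧
      ∀ w ∈ LinearMap.ker f, ∀ i, w i ∈ maximalIdeal R := by
  let b := Module.finBasis (ResidueField R) (ResidueField R ⊗[R] M)
  choose v hv using fun i ↦
    TensorProduct.mk_surjective R M (ResidueField R) Ideal.Quotient.mk_surjective (b i)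
  refine ⟨_, Fintype.linearCombination R v, ?_, fun w hw i ↦ ?_⟩
  · rw [← LinearMap.range_eq_top, Fintype.range_linearCombination]
    exact span_eq_top_of_tmul_eq_basis v b hv
  · rw [LinearMap.mem_ker, Fintype.linearCombination_apply] at hw
    have h0 : ∑ i, residue R (w i) • b i = 0 := by
      have := congrArg (TensorProduct.mk R (ResidueField R) M 1) hw
      rw [map_sum, map_zero] at this
      rw [← this]
      refine Finset.sum_congr rfl fun i _ ↦ ?_
      rw [map_smul, hv]
      exact algebraMap_smul (ResidueField R) (w i) (b i)
    exact (residue_eq_zero_iff _).1 (Fintype.linearIndependent_iff.1 b.linearIndependent _ h0 i)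

/-- A nontrivial Artinian module over a local ring has nonzero socle. -/
theorem IsLocalRing.exists_ne_zero_forall_smul_eq_zero {R : Type*} [CommRing R] [IsLocalRing R]
    (T : Type*) [AddCommGroup T] [Module R T] [IsArtinian R T] [Nontrivial T] :
    ∃ s : T, s ≠ 0 ∧ ∀ r ∈ maximalIdeal R, r • s = 0 := by
  obtain ⟨S, hS⟩ := IsAtomic.exists_atom (Submodule R T)
  have : IsSimpleModule R S := isSimpleModule_iff_isAtom.2 hS
  have hmax := eq_maximalIdeal (IsSimpleModule.annihilator_isMaximal (R := R) (M := S))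
  obtain ⟨s, hs, hs0⟩ := S.exists_mem_ne_zero_of_ne_bot hS.1
  refine ⟨s, hs0, fun r hr ↦ ?_⟩
  rw [← hmax, Module.mem_annihilator] at hr
  simpa using congrArg Subtype.val (hr ⟨s, hs⟩)

/-- Over a local ring, a tensor product of nonzero finitely generated modules is nonzero. -/
theorem IsLocalRing.nontrivial_tensorProduct {R : Type*} [CommRing R] [IsLocalRing R]
    (M N : Type*) [AddCommGroup M] [Module R M] [Module.Finite R M] [Nontrivial M]
    [AddCommGroup N] [Module R N] [Module.Finite R N] [Nontrivial N] :
    Nontrivial (M ⊗[R] N) := by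
  let k := ResidueField R
  have hM : Nontrivial (k ⊗[R] M) := by
    rw [← not_subsingleton_iff_nontrivial, subsingleton_tensorProduct]
    exact not_subsingleton M
  have hN : Nontrivial (k ⊗[R] N) := by
    rw [← not_subsingleton_iff_nontrivial, subsingleton_tensorProduct]
    exact not_subsingleton N
  have h : Nontrivial ((k ⊗[R] M) ⊗[k] (k ⊗[R] N)) := inferInstance
  have h' : Nontrivial (k ⊗[R] (M ⊗[R] N)) :=
    (AlgebraTensorModule.distribBaseChange R k M N).toEquiv.nontrivial
  rw [← not_subsingleton_iff_nontrivial, subsingleton_tensorProduct] at h'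
  exact not_subsingleton_iff_nontrivial.1 h'

instance TensorProduct.isArtinian_of_finite {R : Type*} [CommRing R]
    (M N : Type*) [AddCommGroup M] [Module R M] [Module.Finite R M]
    [AddCommGroup N] [Module R N] [IsArtinian R N] : IsArtinian R (M ⊗[R] N) := by
  obtain ⟨n, f, hf⟩ := Module.Finite.exists_fin' R M
  have : IsArtinian R ((Fin n → R) ⊗[R] N) := isArtinian_of_linearEquiv
    ((TensorProduct.piScalarRight R R N (Fin n)).symm ≪≫ₗ TensorProduct.comm R N (Fin n → R))
  exact isArtinian_of_surjective _ (f.rTensor N) (LinearMap.rTensor_surjective N hf)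

/-- If `N` is weakly `𝔪`-full in `X` and `K ⊆ 𝔪 Rⁿ` is such that `K ⊗ X/N → Rⁿ ⊗ X/N` is
injective, then `K = 0`: a socle element of `K ⊗ X/N` lifts along `Rⁿ ⊗ X/𝔪N → Rⁿ ⊗ X/N` to a
socle element, and the socle of `X/𝔪N` is `N/𝔪N`. -/
theorem Submodule.eq_bot_of_rTensor_injective_of_weaklyFull
    {R X : Type u} [CommRing R] [IsNoetherianRing R] [IsLocalRing R]
    [AddCommGroup X] [Module R X] [Module.Finite R X] (N : Submodule R X)
    (hwmf : Submodule.colonBy (maximalIdeal R • N) (maximalIdeal R) = N)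
    (hN : N ≠ ⊤) [IsArtinian R (X ⧸ N)] {n : ℕ} (K : Submodule R (Fin n → R))
    (hK : ∀ w ∈ K, ∀ i, w i ∈ maximalIdeal R)
    (hinj : Function.Injective (K.subtype.rTensor (X ⧸ N))) : K = ⊥ := by
  by_contra hne
  have : Nontrivial K := Submodule.nontrivial_iff_ne_bot.2 hne
  have : Nontrivial (X ⧸ N) := Submodule.Quotient.nontrivial_iff.2 hN
  have := nontrivial_tensorProduct (R := R) K (X ⧸ N)
  obtain ⟨s, hs0, hs⟩ := exists_ne_zero_forall_smul_eq_zero (R := R) (K ⊗[R] (X ⧸ N))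
  let q : X ⧸ (maximalIdeal R • N) →ₗ[R] X ⧸ N :=
    Submodule.mapQ _ _ LinearMap.id Submodule.smul_le_right
  let α (i : Fin n) : K ⊗[R] (X ⧸ N) →ₗ[R] X ⧸ (maximalIdeal R • N) :=
    TensorProduct.lift
      { toFun := fun w ↦ N.liftQ ((w.1 i) • (maximalIdeal R • N).mkQ) fun x hx ↦ by
          simpa [← Submodule.Quotient.mk_smul] using
            (Submodule.Quotient.mk_eq_zero _).2 (Submodule.smul_mem_smul (hK w w.2 i) hx)
        map_add' := fun v w ↦ by ext x; simp [add_smul]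
        map_smul' := fun r w ↦ by ext x; simp [mul_smul] }
  have hα (i : Fin n) : q (α i s) = 0 := by
    obtain ⟨x, hx⟩ := Submodule.mkQ_surjective _ (α i s)
    rw [← hx]
    refine (Submodule.Quotient.mk_eq_zero _).2 ?_
    rw [LinearMap.id_apply, ← hwmf]
    intro r hr
    rw [← Submodule.Quotient.mk_eq_zero, Submodule.Quotient.mk_smul]
    rw [Submodule.mkQ_apply] at hx
    rw [hx, ← map_smul, hs r hr, map_zero]
  let e : (Fin n → R) ⊗[R] (X ⧸ N) ≃ₗ[R] (Fin n → X ⧸ N) :=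
    TensorProduct.comm R _ _ ≪≫ₗ TensorProduct.piScalarRight R R (X ⧸ N) (Fin n)
  have hcomp : e.toLinearMap ∘ₗ K.subtype.rTensor (X ⧸ N) = LinearMap.pi fun i ↦ q ∘ₗ α i := by
    ext w x i
    simp [e, q, α]
  apply hs0
  apply hinj
  apply e.injective
  rw [map_zero, map_zero]
  ext i
  have := congrFun (LinearMap.congr_fun hcomp s) i
  simpa [hα] using this

theorem LinearMap.rTensor_lTensor_comm {R A B C D : Type*} [CommRing R]
    [AddCommGroup A] [Module R A] [AddCommGroup B] [Module R B]
    [AddCommGroup C] [Module R C] [AddCommGroup D] [Module R D]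
    (f : A →ₗ[R] B) (g : C →ₗ[R] D) (x : A ⊗[R] C) :
    f.rTensor D (g.lTensor A x) = g.lTensor B (f.rTensor C x) := by
  rw [← LinearMap.comp_apply, ← LinearMap.comp_apply, LinearMap.rTensor_comp_lTensor,
    LinearMap.lTensor_comp_rTensor]

/-- Dimension shifting, at the level of elements: if `0 → K → F → M → 0` is exact and `M ⊗ P` is
exact at `P₁`, an element of `K ⊗ P₀` that bounds in `F ⊗ P₀` already bounds in `K ⊗ P₀`. -/
theorem LinearMap.mem_range_lTensor_of_exact {R : Type*} [CommRing R]
    {K F M P₂ P₁ P₀ : Type*} [AddCommGroup K] [Module R K] [AddCommGroup F] [Module R F]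
    [AddCommGroup M] [Module R M] [AddCommGroup P₂] [Module R P₂] [AddCommGroup P₁] [Module R P₁]
    [AddCommGroup P₀] [Module R P₀] [Module.Flat R P₀]
    {i : K →ₗ[R] F} {p : F →ₗ[R] M} (hi : Function.Injective i) (hip : Function.Exact i p)
    (hp : Function.Surjective p) {d₂ : P₂ →ₗ[R] P₁} {d₁ : P₁ →ₗ[R] P₀} (hd : d₁ ∘ₗ d₂ = 0)
    (hM : Function.Exact (d₂.lTensor M) (d₁.lTensor M))
    {z : K ⊗[R] P₀} {w : F ⊗[R] P₁} (hzw : i.rTensor P₀ z = d₁.lTensor F w) :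
    z ∈ LinearMap.range (d₁.lTensor K) := by
  have hcyc : d₁.lTensor M (p.rTensor P₁ w) = 0 := by
    rw [← rTensor_lTensor_comm, ← hzw, ← LinearMap.comp_apply, ← LinearMap.rTensor_comp, hip.linearMap_comp_eq_zero]
    simp
  obtain ⟨v, hv⟩ := (hM _).1 hcyc
  obtain ⟨v, rfl⟩ := LinearMap.rTensor_surjective P₂ hp v
  obtain ⟨u, hu⟩ := (rTensor_exact P₁ hip hp (w - d₂.lTensor F v)).1 (by
    rw [map_sub, rTensor_lTensor_comm, hv, sub_self])
  refine ⟨u, Module.Flat.rTensor_preserves_injective_linearMap i hi ?_⟩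
  rw [rTensor_lTensor_comm, hu, map_sub, ← hzw, ← LinearMap.comp_apply, ← LinearMap.lTensor_comp, hd]
  simp

section Tor

open Limits

variable {R : Type u} [CommRing R]

theorem TorIsZero.exact_lTensor {M Q : Type u} [AddCommGroup M] [Module R M]
    [AddCommGroup Q] [Module R Q] (P : ProjectiveResolution (ModuleCat.of R Q)) {n : ℕ}
    (h : TorIsZero R M Q (n + 1)) :
    Function.Exact ((P.complex.d (n + 2) (n + 1)).hom.lTensor M)
      ((P.complex.d (n + 1) n).hom.lTensor M) := by
  have hz : IsZero (((Tor (ModuleCat.{u} R) (n + 1)).obj (ModuleCat.of R M)).obj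
      (ModuleCat.of R Q)) := ModuleCat.isZero_iff_subsingleton.2 h
  have hz' := hz.of_iso (P.isoLeftDerivedObj
    ((MonoidalCategory.tensoringLeft (ModuleCat.{u} R)).obj (ModuleCat.of R M)) (n + 1)).symm
  have hex := (HomologicalComplex.exactAt_iff_isZero_homology _ _).2 hz'
  rw [HomologicalComplex.exactAt_iff' _ (n + 2) (n + 1) n (by simp) (by simp)] at hex
  exact LinearMap.exact_iff.2 ((ShortComplex.moduleCat_exact_iff_range_eq_ker _).1 hex).symm

theorem CategoryTheory.ProjectiveResolution.exact_d_succ {Q : ModuleCat.{u} R}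
    (P : ProjectiveResolution Q) (n : ℕ) :
    Function.Exact (P.complex.d (n + 2) (n + 1)).hom (P.complex.d (n + 1) n).hom :=
  LinearMap.exact_iff.2 ((ShortComplex.moduleCat_exact_iff_range_eq_ker _).1 (P.exact_succ n)).symm

theorem CategoryTheory.ProjectiveResolution.exact_d_zero {Q : ModuleCat.{u} R}
    (P : ProjectiveResolution Q) :
    Function.Exact (P.complex.d 1 0).hom (P.π.f 0).hom :=
  LinearMap.exact_iff.2 ((ShortComplex.moduleCat_exact_iff_range_eq_ker _).1 P.exact₀).symm

instance (Q : ModuleCat.{u} R) (P : ProjectiveResolution Q) (n : ℕ) :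
    Module.Projective R (P.complex.X n) :=
  (IsProjective.iff_projective _).2 (P.projective n)

theorem HasProjDimLT.of_projective (M : Type u) [AddCommGroup M] [Module R M]
    [Module.Projective R M] {t : ℕ} (ht : 1 ≤ t) : HasProjDimLT R M t := by
  have : Projective (ModuleCat.of R M) := (IsProjective.iff_projective _).1 inferInstance
  exact ⟨ProjectiveResolution.self _, fun i hi ↦
    HomologicalComplex.isZero_single_obj_X _ _ _ _ (by omega)⟩

theorem HasProjDimLT.of_exact {K F M : Type u} [AddCommGroup K] [Module R K]
    [AddCommGroup F] [Module R F] [AddCommGroup M] [Module R M] [Module.Projective R F]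
    {i : K →ₗ[R] F} {p : F →ₗ[R] M} (hi : Function.Injective i) (hip : Function.Exact i p)
    (hp : Function.Surjective p) {t : ℕ} (h : HasProjDimLT R K t) : HasProjDimLT R M (t + 1) := by
  obtain ⟨P, hP⟩ := h
  have hF : Projective (ModuleCat.of R F) := (IsProjective.iff_projective _).1 inferInstance
  have hπ : Function.Surjective (P.π.f 0).hom := (ModuleCat.epi_iff_surjective _).1 inferInstance
  let f : P.complex.X 0 ⟶ ModuleCat.of R F := P.π.f 0 ≫ ModuleCat.ofHom i
  have hf : P.complex.d 1 0 ≫ f = 0 := by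
    ext x
    exact (congrArg i (P.exact_d_zero.apply_apply_eq_zero x)).trans (map_zero i)
  let C := P.complex.augment f hf
  have hw : C.d 1 0 ≫ ModuleCat.ofHom p = 0 := by
    ext x
    exact hip.apply_apply_eq_zero _
  have hex₀ : (ShortComplex.mk (C.d 1 0) (ModuleCat.ofHom p) hw).Exact := by
    rw [ShortComplex.moduleCat_exact_iff]
    intro x hx
    obtain ⟨y, rfl⟩ := (hip x).1 hx
    obtain ⟨z, rfl⟩ := hπ y
    exact ⟨z, rfl⟩
  have hex₁ : (ShortComplex.mk (C.d 2 1) (C.d 1 0) (C.d_comp_d _ _ _)).Exact := by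
    rw [ShortComplex.moduleCat_exact_iff]
    intro x hx
    exact (P.exact_d_zero x).1 (hi (hx.trans (map_zero i).symm))
  have hexAt (n : ℕ) : C.ExactAt (n + 1) := by
    rw [HomologicalComplex.exactAt_iff' _ (n + 2) (n + 1) n (by simp) (by simp)]
    cases n with
    | zero => exact hex₁
    | succ n => exact P.exact_succ n
  refine ⟨{
    complex := C
    projective := fun n ↦ by
      cases n with
      | zero => exact hF
      | succ n => exact P.projective n
    π := (ChainComplex.toSingle₀Equiv _ _).symm ⟨ModuleCat.ofHom p, hw⟩
    quasiIso := ⟨fun n ↦ ?_⟩ }, fun n hn ↦ ?_⟩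
  · cases n with
    | zero =>
      rw [ChainComplex.quasiIsoAt₀_iff, ShortComplex.quasiIso_iff_of_zeros']
      · refine (ShortComplex.exact_and_epi_g_iff_of_iso ?_).2
          ⟨hex₀, (ModuleCat.epi_iff_surjective _).2 hp⟩
        exact ShortComplex.isoMk (Iso.refl _) (Iso.refl _) (Iso.refl _)
          ((Category.id_comp _).trans (Category.comp_id _).symm)
          ((Category.id_comp _).trans ((Category.comp_id _).trans
            (ChainComplex.toSingle₀Equiv_symm_apply_f_zero (C := C) (ModuleCat.ofHom p) hw)).symm)
      all_goals rfl
    | succ n =>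
      rw [quasiIsoAt_iff_exactAt']
      · exact hexAt n
      · apply ChainComplex.exactAt_succ_single_obj
  · obtain ⟨n, rfl⟩ : ∃ m, n = m + 1 := ⟨n - 1, by omega⟩
    exact hP n (by omega)

/-- If `Rⁿ → M` is a minimal cover with kernel `K`, then exactness of `M ⊗ P` in degree `t`
descends to `K` until it forces `K = 0`. -/
theorem HasProjDimLT.of_weaklyFull_of_exact_lTensor [IsNoetherianRing R] [IsLocalRing R]
    {X : Type u} [AddCommGroup X] [Module R X] [Module.Finite R X] (N : Submodule R X)
    (hwmf : Submodule.colonBy (maximalIdeal R • N) (maximalIdeal R) = N)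
    (hN : N ≠ ⊤) [IsArtinian R (X ⧸ N)] (P : ProjectiveResolution (ModuleCat.of R (X ⧸ N)))
    (n : ℕ) (M : Type u) [AddCommGroup M] [Module R M] [Module.Finite R M]
    (h : Function.Exact ((P.complex.d (n + 2) (n + 1)).hom.lTensor M)
      ((P.complex.d (n + 1) n).hom.lTensor M)) :
    HasProjDimLT R M (n + 1) := by
  obtain ⟨r, p, hp, hmin⟩ := IsLocalRing.exists_minimal_free_cover R M
  have hip : Function.Exact (LinearMap.ker p).subtype p := LinearMap.exact_subtype_ker_map p
  have hi := (LinearMap.ker p).injective_subtype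
  have hd (m : ℕ) : (P.complex.d (m + 1) m).hom ∘ₗ (P.complex.d (m + 2) (m + 1)).hom = 0 := by
    rw [← ModuleCat.hom_comp, P.complex.d_comp_d, ModuleCat.hom_zero]
  induction n generalizing M r with
  | zero =>
    have hπ : Function.Surjective (P.π.f 0).hom := (ModuleCat.epi_iff_surjective _).1 inferInstance
    have hinj : Function.Injective ((LinearMap.ker p).subtype.rTensor (X ⧸ N)) := by
      rw [injective_iff_map_eq_zero]
      intro s hs
      obtain ⟨z, rfl⟩ := LinearMap.lTensor_surjective (LinearMap.ker p) hπ s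
      have hs' : (P.π.f 0).hom.lTensor (Fin r → R)
          ((LinearMap.ker p).subtype.rTensor (P.complex.X 0) z) = 0 :=
        (LinearMap.rTensor_lTensor_comm _ _ _).symm.trans hs
      obtain ⟨w, hw⟩ := (lTensor_exact (Fin r → R) P.exact_d_zero hπ _).1 hs'
      obtain ⟨u, rfl⟩ := LinearMap.mem_range_lTensor_of_exact hi hip hp (hd 0) h hw.symm
      exact (lTensor_exact _ P.exact_d_zero hπ).apply_apply_eq_zero u
    have hbot := Submodule.eq_bot_of_rTensor_injective_of_weaklyFull N hwmf hN _ hmin hinj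
    have : Module.Projective R M := Module.Projective.of_equiv
      (LinearEquiv.ofBijective p ⟨LinearMap.ker_eq_bot.1 hbot, hp⟩)
    exact .of_projective M le_rfl
  | succ n ih =>
    refine .of_exact hi hip hp ?_
    obtain ⟨r', p', hp', hmin'⟩ := IsLocalRing.exists_minimal_free_cover R (LinearMap.ker p)
    refine ih _ (fun z ↦ ⟨fun hz ↦ ?_, ?_⟩) r' p' hp' hmin'
      (LinearMap.exact_subtype_ker_map p') (LinearMap.ker p').injective_subtype
    · have hz' : (P.complex.d (n + 1) n).hom.lTensor (Fin r → R)
          ((LinearMap.ker p).subtype.rTensor (P.complex.X (n + 1)) z) = 0 := by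
        rw [← LinearMap.rTensor_lTensor_comm, hz, map_zero]
      obtain ⟨w, hw⟩ := (Module.Flat.lTensor_exact (Fin r → R) (P.exact_d_succ n) _).1 hz'
      exact LinearMap.mem_range_lTensor_of_exact hi hip hp (hd (n + 1)) h hw.symm
    · rintro ⟨y, rfl⟩
      rw [← LinearMap.comp_apply, ← LinearMap.lTensor_comp, hd n]
      simp

end Tor

/-- Over a Noetherian local ring `(R, 𝔪)`, let `X` be finitely generated and
faithful, and let `N` be a weakly `𝔪`-full submodule of `X` (i.e. `(𝔪N :_X 𝔪) = N`) with
`N ⊆ 𝔪X` and `X/N` of finite length. If `M` is finitely generated, `t ≥ 1` and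
`Tor_t^R(M, X/N) = 0`, then `pd_R M < t`. -/
theorem weakly_m_full_tor_quotient_vanishing
    {R : Type u} [CommRing R] [IsNoetherianRing R] [IsLocalRing R]
    {M : Type u} [AddCommGroup M] [Module R M] [Module.Finite R M]
    {X : Type u} [AddCommGroup X] [Module R X] [Module.Finite R X]
    (hfaith : Module.annihilator R X = ⊥)
    (N : Submodule R X)
    (hwmf : Submodule.colonBy (IsLocalRing.maximalIdeal R • N) (IsLocalRing.maximalIdeal R) = N)
    (hsub : N ≤ IsLocalRing.maximalIdeal R • (⊤ : Submodule R X))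
    (hlen : IsFiniteLength R (X ⧸ N))
    (t : ℕ) (ht : 1 ≤ t)
    (h : TorIsZero R M (X ⧸ N) t) :
    HasProjDimLT R M t := by
  have hN : N ≠ ⊤ := by
    rintro rfl
    have hX : (⊤ : Submodule R X) = ⊥ := Submodule.eq_bot_of_le_smul_of_le_jacobson_bot _ _
      Module.Finite.fg_top hsub (maximalIdeal_le_jacobson _)
    have : Subsingleton X := (Submodule.subsingleton_iff R).1 (subsingleton_of_bot_eq_top hX.symm)
    rw [Module.annihilator_eq_top_iff.2 this] at hfaith
    exact top_ne_bot hfaith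
  have : IsArtinian R (X ⧸ N) := (isFiniteLength_iff_isNoetherian_isArtinian.1 hlen).2
  obtain ⟨n, rfl⟩ : ∃ n, t = n + 1 := ⟨t - 1, by omega⟩
  let P := ProjectiveResolution.of (ModuleCat.of R (X ⧸ N))
  exact .of_weaklyFull_of_exact_lTensor N hwmf hN P n M (h.exact_lTensor P)
end

section
/- Let (R,m,k) be a commutative Noetherian local ring, let X be a finitely generated R-module and let N be a Burch submodule of X with depth_R(N) > 0. Let M be a finitely generated R-module. If there exists an integer t with t ≥ 1 and t ≥ depth_R(M) such that Ext^t_R(N, M) = 0 and Ext^{t-1}_R(N, M) = 0, then M has finite injective dimension. -/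
open CategoryTheory

universe u

section

open Abelian IsLocalRing

section

lemma extIsZero_iff_exactAt {R : Type u} [CommRing R] {A B : Type u} [AddCommGroup A] [Module R A]
    [AddCommGroup B] [Module R B] (P : ProjectiveResolution (ModuleCat.of R A)) (n : ℕ) :
    ExtIsZero R A B n ↔ (P.complex.linearYonedaObj R (ModuleCat.of R B)).ExactAt n := by
  rw [HomologicalComplex.exactAt_iff_isZero_homology, ExtIsZero,
    ← ModuleCat.isZero_iff_subsingleton]
  exact (P.isoExt n (ModuleCat.of R B)).isZero_iff

lemma extIsZero_iff {R : Type u} [CommRing R] {A B : Type u} [AddCommGroup A] [Module R A]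
    [AddCommGroup B] [Module R B] (n : ℕ) :
    ExtIsZero R A B n ↔
      Subsingleton (Abelian.Ext (ModuleCat.of R A) (ModuleCat.of R B) n) := by
  let P := ProjectiveResolution.of (ModuleCat.of R A)
  rw [extIsZero_iff_exactAt P]
  cases n with
  | zero =>
    rw [HomologicalComplex.exactAt_iff' _ 0 0 1 (by simp) (by simp), ShortComplex.moduleCat_exact_iff]
    rw [Abelian.Ext.homEquiv₀.subsingleton_congr]
    have hd : P.complex.d 0 0 = 0 := P.complex.shape _ _ (by simp)
    obtain ⟨p, hp, hpd, hpl⟩ : ∃ p : P.complex.X 0 ⟶ ModuleCat.of R A, Epi p ∧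
        P.complex.d 1 0 ≫ p = 0 ∧ ∀ f : P.complex.X 0 ⟶ ModuleCat.of R B,
          P.complex.d 1 0 ≫ f = 0 → ∃ g, p ≫ g = f :=
      ⟨P.π.f 0, inferInstanceAs (Epi (P.π.f 0)), P.complex_d_comp_π_f_zero, fun f hf =>
        ⟨P.isColimitCokernelCofork.desc (Limits.CokernelCofork.ofπ f hf),
          P.isColimitCokernelCofork.fac _ Limits.WalkingParallelPair.one⟩⟩
    constructor
    · intro h
      refine subsingleton_of_forall_eq 0 fun f => ?_
      have hpf : P.complex.d 1 0 ≫ p ≫ f = 0 := by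
        rw [← Category.assoc, hpd, Limits.zero_comp]
      obtain ⟨g : P.complex.X 0 ⟶ ModuleCat.of R B, hg⟩ := h (p ≫ f) hpf
      replace hg : P.complex.d 0 0 ≫ g = p ≫ f := hg
      rw [hd, Limits.zero_comp] at hg
      rw [← cancel_epi p, ← hg, Limits.comp_zero]
    · intro h (f : P.complex.X 0 ⟶ ModuleCat.of R B) hf
      obtain ⟨g, rfl⟩ := hpl f hf
      obtain rfl : g = 0 := Subsingleton.elim _ _
      refine ⟨0, ?_⟩
      rw [Limits.comp_zero]
      exact map_zero _
  | succ n =>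
    rw [HomologicalComplex.exactAt_iff' _ n (n+1) (n+2) (by simp) (by simp), ShortComplex.moduleCat_exact_iff]
    constructor
    · intro h
      refine subsingleton_of_forall_eq 0 fun e => ?_
      obtain ⟨f, hf, rfl⟩ := P.extMk_surjective e (n+2) rfl
      rw [P.extMk_eq_zero_iff _ _ _ _ n rfl]
      exact h f hf
    · intro h f hf
      have := (P.extMk_eq_zero_iff f (n+2) rfl hf n rfl).1 (Subsingleton.elim _ _)
      exact this

end

section

variable {R : Type u} [CommRing R]

/-- Pulling back an `Ext`-class along a linear map in the first variable. -/
noncomputable def Ext.pull {A B : Type u} [AddCommGroup A] [Module R A] [AddCommGroup B]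
    [Module R B] {Y : ModuleCat.{u} R} {n : ℕ} (f : A →ₗ[R] B) (e : Ext (ModuleCat.of R B) Y n) :
    Ext (ModuleCat.of R A) Y n :=
  (Ext.mk₀ (ModuleCat.ofHom f)).comp e (zero_add n)

section pull

variable {A B C : Type u} [AddCommGroup A] [Module R A] [AddCommGroup B] [Module R B]
  [AddCommGroup C] [Module R C] {Y Y' : ModuleCat.{u} R} {n m k : ℕ}

lemma Ext.pull_pull (f : A →ₗ[R] B) (g : B →ₗ[R] C) (e : Ext (ModuleCat.of R C) Y n) :
    Ext.pull f (Ext.pull g e) = Ext.pull (g ∘ₗ f) e := by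
  simp only [Ext.pull, Ext.mk₀_comp_mk₀_assoc]
  rfl

lemma Ext.pull_id (e : Ext (ModuleCat.of R A) Y n) :
    Ext.pull (LinearMap.id : A →ₗ[R] A) e = e :=
  Ext.mk₀_id_comp e

@[simp]
lemma Ext.pull_zero (f : A →ₗ[R] B) : Ext.pull f (0 : Ext (ModuleCat.of R B) Y n) = 0 := by
  simp [Ext.pull]

lemma Ext.pull_smul_id (r : R) (e : Ext (ModuleCat.of R A) Y n) :
    Ext.pull (r • (LinearMap.id : A →ₗ[R] A)) e = r • e := by
  have : ModuleCat.ofHom (r • (LinearMap.id : A →ₗ[R] A)) = r • 𝟙 (ModuleCat.of R A) := rfl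
  rw [Ext.pull, this, Ext.mk₀_smul, Ext.smul_comp, Ext.mk₀_id_comp]

lemma Ext.pull_comp (f : A →ₗ[R] B) (e : Ext (ModuleCat.of R B) Y n) (e' : Ext Y Y' m)
    (h : n + m = k) : Ext.pull f (e.comp e' h) = (Ext.pull f e).comp e' h := by
  rw [Ext.pull, Ext.pull, Ext.comp_assoc _ _ _ _ _ (by omega)]

/-- A pair of composable linear maps forming a short exact sequence. -/
structure LinearMap.IsSES (f : A →ₗ[R] B) (g : B →ₗ[R] C) : Prop where
  inj : Function.Injective f
  exact : Function.Exact f g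
  surj : Function.Surjective g

namespace LinearMap.IsSES

variable {f : A →ₗ[R] B} {g : B →ₗ[R] C}

lemma shortExact (h : IsSES f g) : (ModuleCat.shortComplexOfCompEqZero f g
    h.exact.linearMap_comp_eq_zero).ShortExact :=
  ModuleCat.shortComplex_shortExact _ h.exact h.inj h.surj

lemma exists_pull_left (h : IsSES f g) (hC : Subsingleton (Ext (ModuleCat.of R C) Y (n + 1)))
    (e : Ext (ModuleCat.of R A) Y n) : ∃ e', Ext.pull f e' = e :=
  Ext.contravariant_sequence_exact₁ h.shortExact Y e (add_comm 1 n)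
    (hC.elim _ _)

lemma exists_pull_right (h : IsSES f g) (e : Ext (ModuleCat.of R B) Y n)
    (he : Ext.pull f e = 0) : ∃ e', Ext.pull g e' = e :=
  Ext.contravariant_sequence_exact₂ h.shortExact Y e he

lemma exists_extClass_comp (h : IsSES f g) (e : Ext (ModuleCat.of R C) Y (n + 1))
    (he : Ext.pull g e = 0) : ∃ e', h.shortExact.extClass.comp e' (add_comm 1 n) = e :=
  Ext.contravariant_sequence_exact₃ h.shortExact Y e he (add_comm 1 n)

lemma eq_zero_of_pull_right (h : IsSES f g) (hA : Subsingleton (Ext (ModuleCat.of R A) Y n))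
    (e : Ext (ModuleCat.of R C) Y (n + 1)) (he : Ext.pull g e = 0) : e = 0 := by
  obtain ⟨e', rfl⟩ := h.exists_extClass_comp e he
  rw [hA.elim e' 0, Ext.comp_zero]

lemma subsingleton_right (h : IsSES f g) (hA : Subsingleton (Ext (ModuleCat.of R A) Y n))
    (hB : Subsingleton (Ext (ModuleCat.of R B) Y (n + 1))) :
    Subsingleton (Ext (ModuleCat.of R C) Y (n + 1)) :=
  subsingleton_of_forall_eq 0 fun e => h.eq_zero_of_pull_right hA e (hB.elim _ _)

lemma subsingleton_mid (h : IsSES f g) (hA : Subsingleton (Ext (ModuleCat.of R A) Y n))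
    (hC : Subsingleton (Ext (ModuleCat.of R C) Y n)) :
    Subsingleton (Ext (ModuleCat.of R B) Y n) :=
  subsingleton_of_forall_eq 0 fun e => by
    obtain ⟨e', rfl⟩ := h.exists_pull_right e (hA.elim _ _)
    rw [hC.elim e' 0, Ext.pull_zero]

end LinearMap.IsSES

lemma LinearMap.isSES_ker {g : B →ₗ[R] C} (hg : Function.Surjective g) :
    LinearMap.IsSES (LinearMap.ker g).subtype g :=
  ⟨Subtype.val_injective, LinearMap.exact_subtype_ker_map g, hg⟩

lemma LinearMap.isSES_range {f : A →ₗ[R] B} (hf : Function.Injective f) :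
    LinearMap.IsSES f (LinearMap.range f).mkQ :=
  ⟨hf, f.exact_map_mkQ_range, Submodule.mkQ_surjective _⟩

/-- `Ext` vanishing passes to retracts in the first variable. -/
lemma Ext.subsingleton_of_retract {f : A →ₗ[R] B} {g : B →ₗ[R] A} (h : g ∘ₗ f = LinearMap.id)
    (hB : Subsingleton (Ext (ModuleCat.of R B) Y n)) :
    Subsingleton (Ext (ModuleCat.of R A) Y n) :=
  subsingleton_of_forall_eq 0 fun e => by
    rw [← Ext.pull_id e, ← h, ← Ext.pull_pull, hB.elim (Ext.pull g e) 0, Ext.pull_zero]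

lemma Ext.subsingleton_of_linearEquiv (f : A ≃ₗ[R] B)
    (hB : Subsingleton (Ext (ModuleCat.of R B) Y n)) :
    Subsingleton (Ext (ModuleCat.of R A) Y n) :=
  Ext.subsingleton_of_retract (f := f.toLinearMap) (g := f.symm.toLinearMap)
    (by ext; simp) hB

/-- If `r` acts bijectively on `A` and nilpotently on `Y`, then `Ext n A Y = 0`. -/
lemma Ext.subsingleton_of_bijective_smul {A B : Type u} [AddCommGroup A] [Module R A]
    [AddCommGroup B] [Module R B] {r : R}
    (hr : Function.Bijective fun a : A => r • a) {j : ℕ} (hj : ∀ b : B, r ^ j • b = 0) :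
    Subsingleton (Ext (ModuleCat.of R A) (ModuleCat.of R B) n) :=
  subsingleton_of_forall_eq 0 fun e => by
    have key : ∀ e : Ext (ModuleCat.of R A) (ModuleCat.of R B) n, r ^ j • e = 0 := fun e => by
      have h0 : r ^ j • 𝟙 (ModuleCat.of R B) = 0 := by
        ext b
        exact hj b
      rw [Ext.smul_eq_comp_mk₀, h0, Ext.mk₀_zero, Ext.comp_zero]
    have hinv : IsUnit (Module.toModuleEnd R A (r ^ j)) := by
      rw [map_pow]
      exact ((Module.End.isUnit_iff _).2 hr).pow j
    obtain ⟨φ, hφ⟩ := hinv.exists_left_inv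
    have : (r ^ j • (LinearMap.id : A →ₗ[R] A)) ∘ₗ φ = LinearMap.id := by
      ext a
      have := LinearMap.congr_fun hφ a
      simp at this
      simpa using this
    rw [← Ext.pull_id e, ← this, ← Ext.pull_pull, Ext.pull_smul_id, key, Ext.pull_zero]

end pull

end

section

section residue

variable {R : Type u} [CommRing R] [IsLocalRing R] {A : Type u} [AddCommGroup A] [Module R A]

/-- The map from the residue field determined by an element of the socle. -/
noncomputable def socleMap (z : A) (hz : ∀ r ∈ maximalIdeal R, r • z = 0) :
    (R ⧸ maximalIdeal R) →ₗ[R] A :=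
  (maximalIdeal R).liftQ (LinearMap.toSpanSingleton R A z) fun r hr => by
    simpa using hz r hr

@[simp]
lemma socleMap_one (z : A) (hz : ∀ r ∈ maximalIdeal R, r • z = 0) :
    socleMap z hz (Submodule.Quotient.mk 1) = z :=
  (Submodule.liftQ_apply _ _ _).trans (one_smul R z)

lemma residue_hom_ext {f g : (R ⧸ maximalIdeal R) →ₗ[R] A}
    (h : f (Submodule.Quotient.mk 1) = g (Submodule.Quotient.mk 1)) : f = g := by
  refine Submodule.linearMap_qext _ ?_
  ext
  exact h

lemma smul_residue_hom_one (f : (R ⧸ maximalIdeal R) →ₗ[R] A) {r : R}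
    (hr : r ∈ maximalIdeal R) : r • f (Submodule.Quotient.mk 1) = 0 := by
  rw [← map_smul, ← Submodule.Quotient.mk_smul,
    (Submodule.Quotient.mk_eq_zero _).2 (by simpa using hr), map_zero]

lemma residue_hom_injective {f : (R ⧸ maximalIdeal R) →ₗ[R] A}
    (h : f (Submodule.Quotient.mk 1) ≠ 0) : Function.Injective f := by
  rw [← LinearMap.ker_eq_bot, eq_bot_iff]
  intro x hx
  obtain ⟨r, rfl⟩ := Submodule.Quotient.mk_surjective _ x
  by_contra hr
  have hu : IsUnit r := by
    by_contra hu
    exact hr ((Submodule.Quotient.mk_eq_zero _).2 hu)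
  obtain ⟨s, hs⟩ := hu.exists_left_inv
  apply h
  have : (Submodule.Quotient.mk 1 : R ⧸ maximalIdeal R) = s • Submodule.Quotient.mk r := by
    rw [← Submodule.Quotient.mk_smul, smul_eq_mul, hs]
  rw [this, map_smul, LinearMap.mem_ker.1 hx, smul_zero]

/-- If `z` is a socle element of a quotient `A ⧸ U` with `U ≤ 𝔪 A` and `z ∉ 𝔪 (A ⧸ U)`,
then the residue field is a direct summand. -/
lemma exists_retraction_socleMap (z : A) (hz : ∀ r ∈ maximalIdeal R, r • z = 0)
    (hz' : z ∉ maximalIdeal R • (⊤ : Submodule R A)) :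
    ∃ g : A →ₗ[R] (R ⧸ maximalIdeal R), g ∘ₗ socleMap z hz = LinearMap.id := by
  let _ : Field (R ⧸ maximalIdeal R) := Ideal.Quotient.field _
  have hne : (Submodule.Quotient.mk z : A ⧸ (maximalIdeal R • (⊤ : Submodule R A))) ≠ 0 :=
    fun h => hz' ((Submodule.Quotient.mk_eq_zero _).1 h)
  obtain ⟨φ, hφ⟩ : ∃ φ : Module.Dual (R ⧸ maximalIdeal R)
      (A ⧸ (maximalIdeal R • (⊤ : Submodule R A))), φ (Submodule.Quotient.mk z) ≠ 0 := by
    by_contra! h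
    exact hne ((Module.forall_dual_apply_eq_zero_iff (R ⧸ maximalIdeal R) _).1 h)
  let ψ := (φ (Submodule.Quotient.mk z))⁻¹ • φ
  refine ⟨(ψ.restrictScalars R) ∘ₗ Submodule.mkQ _, residue_hom_ext ?_⟩
  simp only [LinearMap.comp_apply, socleMap_one, LinearMap.id_apply]
  change (φ (Submodule.Quotient.mk z))⁻¹ * φ (Submodule.Quotient.mk z) = 1
  exact inv_mul_cancel₀ hφ

end residue

/-- A Burch submodule containing a regular element has a quotient by a regular element having
the residue field as a direct summand. -/
lemma Submodule.IsBurch.exists_retract {R : Type u} [CommRing R] [IsNoetherianRing R]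
    [IsLocalRing R] {X : Type u} [AddCommGroup X] [Module R X] [Module.Finite R X]
    {N : Submodule R X} (hN : N.IsBurch)
    (hdepthN : ∃ r ∈ maximalIdeal R, IsSMulRegular (↥N) r) :
    ∃ x : R, IsSMulRegular N x ∧
      ∃ (f : (R ⧸ maximalIdeal R) →ₗ[R]
          (N ⧸ LinearMap.range (x • (LinearMap.id : N →ₗ[R] N))))
        (g : (N ⧸ LinearMap.range (x • (LinearMap.id : N →ₗ[R] N))) →ₗ[R]
          (R ⧸ maximalIdeal R)), g ∘ₗ f = LinearMap.id := by
  set L := N.colonBy (maximalIdeal R) with hL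
  have hNL : N ≤ L := fun y hy r _ => N.smul_mem r hy
  let J : Ideal R := (maximalIdeal R • N).colon (L : Set X)
  have hJ : ¬ maximalIdeal R ≤ J := fun h => hN <| le_antisymm
    (Submodule.smul_le.2 fun r hr y hy => Submodule.mem_colon.1 (h hr) y hy)
    (smul_mono_right _ hNL)
  have hreg : ∀ x : R, IsSMulRegular N x ↔ x ∉ ⋃ p ∈ associatedPrimes R N, (p : Set R) := by
    intro x
    rw [biUnion_associatedPrimes_eq_zero_divisors]
    simp only [Set.mem_ofPred_eq, not_exists, not_and, isSMulRegular_iff_right_eq_zero_of_smul]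
    exact forall_congr' fun y => by tauto
  obtain ⟨x, hxm, hxJ, hx⟩ : ∃ x ∈ maximalIdeal R, x ∉ J ∧ IsSMulRegular N x := by
    by_contra! h
    have hsub : (maximalIdeal R : Set R) ⊆
        ⋃ p ∈ insert J (associatedPrimes R N), ((id p : Ideal R) : Set R) := by
      intro x hx
      rw [Set.biUnion_insert]
      by_cases hxJ : x ∈ J
      · exact Or.inl hxJ
      · exact Or.inr (by
          have := h x hx hxJ
          rw [hreg, not_not] at this
          exact this)
    rw [Ideal.subset_union_prime_finite ((associatedPrimes.finite R N).insert J) J J] at hsub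
    · obtain ⟨p, hp, hmp⟩ := hsub
      rcases hp with rfl | hp
      · exact hJ hmp
      · obtain ⟨r, hr, hr'⟩ := hdepthN
        exact (hreg r).1 hr' (Set.mem_biUnion hp (hmp hr))
    · rintro p (rfl | hp) h1 h2
      · exact absurd rfl h1
      · exact hp.isPrime
  obtain ⟨y, hy, hxy⟩ : ∃ y ∈ L, x • y ∉ maximalIdeal R • N := by
    by_contra! h
    exact hxJ (Submodule.mem_colon.2 h)
  refine ⟨x, hx, ?_⟩
  let w : N := ⟨x • y, hy x hxm⟩
  let U := LinearMap.range (x • (LinearMap.id : N →ₗ[R] N))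
  have hz : ∀ r ∈ maximalIdeal R, r • (Submodule.Quotient.mk w : N ⧸ U) = 0 := by
    intro r hr
    rw [← Submodule.Quotient.mk_smul, Submodule.Quotient.mk_eq_zero]
    exact ⟨⟨r • y, hy r hr⟩, Subtype.ext (smul_comm x r y)⟩
  have hU : U ≤ maximalIdeal R • (⊤ : Submodule R N) := by
    rintro _ ⟨v, rfl⟩
    exact Submodule.smul_mem_smul hxm trivial
  have hz' : (Submodule.Quotient.mk w : N ⧸ U) ∉
      maximalIdeal R • (⊤ : Submodule R (N ⧸ U)) := by
    intro h
    have h1 : Submodule.comap U.mkQ (maximalIdeal R • (⊤ : Submodule R (N ⧸ U))) ≤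
        maximalIdeal R • (⊤ : Submodule R N) := by
      rw [← U.range_mkQ, ← Submodule.map_top, ← Submodule.map_smul'', Submodule.comap_map_eq,
        U.ker_mkQ]
      exact sup_le le_rfl hU
    have h2 : w ∈ maximalIdeal R • (⊤ : Submodule R N) := h1 h
    apply hxy
    have h3 := Submodule.mem_map_of_mem (f := N.subtype) h2
    rw [Submodule.map_smul'', Submodule.map_top, Submodule.range_subtype] at h3
    exact h3
  exact ⟨socleMap _ hz, exists_retraction_socleMap _ hz hz'⟩

/-- Vanishing of two consecutive `Ext` modules of a Burch submodule of positive depth implies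
the vanishing of an `Ext` module of the residue field. -/
lemma Submodule.IsBurch.subsingleton_ext_residueField {R : Type u} [CommRing R]
    [IsNoetherianRing R] [IsLocalRing R] {X : Type u} [AddCommGroup X] [Module R X]
    [Module.Finite R X] {N : Submodule R X} (hN : N.IsBurch)
    (hdepthN : ∃ r ∈ maximalIdeal R, IsSMulRegular (↥N) r) {Y : ModuleCat.{u} R} {t : ℕ}
    (h1 : Subsingleton (Ext (ModuleCat.of R N) Y (t + 1)))
    (h2 : Subsingleton (Ext (ModuleCat.of R N) Y t)) :
    Subsingleton (Ext (ModuleCat.of R (R ⧸ maximalIdeal R)) Y (t + 1)) := by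
  obtain ⟨x, hx, f, g, hgf⟩ := hN.exists_retract hdepthN
  have hses := LinearMap.isSES_range (f := x • (LinearMap.id : N →ₗ[R] N)) hx
  exact Ext.subsingleton_of_retract hgf (hses.subsingleton_right h2 h1)

end

section

variable {R : Type u} [CommRing R]

lemma Ext.subsingleton_of_residueField [IsNoetherianRing R] [IsLocalRing R] {Y : ModuleCat.{u} R}
    [Module.Finite R Y] {t : ℕ}
    (h : ∀ i, t ≤ i → Subsingleton (Ext (ModuleCat.of R (R ⧸ maximalIdeal R)) Y i))
    (I : Ideal R) : ∀ i, t ≤ i → Subsingleton (Ext (ModuleCat.of R (R ⧸ I)) Y i) := by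
  induction I using WellFoundedGT.induction with
  | ind I ih =>
  have hquot : ∀ (W : Submodule R (R ⧸ I)) (a : R), a ∉ I → Submodule.Quotient.mk a ∈ W →
      ∀ i, t ≤ i → Subsingleton (Ext (ModuleCat.of R ((R ⧸ I) ⧸ W)) Y i) := by
    intro W a haI haW i hi
    let f : R →ₗ[R] (R ⧸ I) ⧸ W := W.mkQ ∘ₗ I.mkQ
    have hf : Function.Surjective f :=
      (Submodule.mkQ_surjective W).comp (Submodule.mkQ_surjective I)
    have hlt : I < LinearMap.ker f := by
      refine lt_of_le_of_ne (fun r hr => ?_) fun h => haI ?_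
      · refine (Submodule.Quotient.mk_eq_zero W).2 ?_
        rw [Submodule.mkQ_apply, (Submodule.Quotient.mk_eq_zero I).2 hr]
        exact W.zero_mem
      · rw [h, LinearMap.mem_ker]
        exact (Submodule.Quotient.mk_eq_zero W).2 haW
    exact Ext.subsingleton_of_linearEquiv (f.quotKerEquivOfSurjective hf).symm (ih _ hlt i hi)
  intro i hi
  by_cases htop : I = ⊤
  · have : Subsingleton (R ⧸ I) := Submodule.Quotient.subsingleton_iff.2 htop
    exact subsingleton_of_forall_eq 0 fun e => by
      rw [← Ext.pull_id e, Subsingleton.elim LinearMap.id ((0 : R) • LinearMap.id : (R ⧸ I) →ₗ[R] (R ⧸ I)),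
        Ext.pull_smul_id, zero_smul]
  by_cases hp : I.IsPrime
  · by_cases hm : I = maximalIdeal R
    · exact hm ▸ h i hi
    obtain ⟨x, hxm, hxI⟩ := SetLike.exists_of_lt (lt_of_le_of_ne (le_maximalIdeal htop) hm)
    have hinj : Function.Injective (x • (LinearMap.id : (R ⧸ I) →ₗ[R] (R ⧸ I))) := by
      rw [← LinearMap.ker_eq_bot, eq_bot_iff]
      intro z hz
      obtain ⟨r, rfl⟩ := Submodule.Quotient.mk_surjective _ z
      have h1 : x * r ∈ I := by
        rw [← smul_eq_mul, ← Submodule.Quotient.mk_eq_zero, Submodule.Quotient.mk_smul]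
        exact hz
      exact (Submodule.Quotient.mk_eq_zero _).2 ((hp.mem_or_mem h1).resolve_left hxI)
    have hses := LinearMap.isSES_range hinj
    have hsurj := hses.exists_pull_left (Y := Y) (n := i)
      (hquot _ x hxI (LinearMap.mem_range.2 ⟨Submodule.Quotient.mk 1, by
        change x • (Submodule.Quotient.mk 1 : R ⧸ I) = Submodule.Quotient.mk x
        rw [← Submodule.Quotient.mk_smul, smul_eq_mul, mul_one]⟩) (i + 1) (by omega))
    have hfin : Module.Finite R (Ext (ModuleCat.of R (R ⧸ I)) Y i) := ModuleCat.finite_ext ..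
    have hbot : (⊤ : Submodule R (Ext (ModuleCat.of R (R ⧸ I)) Y i)) = ⊥ := by
      refine Submodule.eq_bot_of_le_smul_of_le_jacobson_bot (maximalIdeal R) _ hfin.fg_top ?_
        (IsLocalRing.maximalIdeal_le_jacobson _)
      intro e _
      obtain ⟨e', rfl⟩ := hsurj e
      rw [Ext.pull_smul_id]
      exact Submodule.smul_mem_smul hxm trivial
    exact (Submodule.subsingleton_iff R).1 (subsingleton_of_bot_eq_top hbot.symm)
  · obtain ⟨a, ha, b, hb, hab⟩ : ∃ a ∉ I, ∃ b ∉ I, a * b ∈ I := by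
      by_contra! hcon
      refine hp ⟨htop, fun {a b} hab => ?_⟩
      by_contra! hab'
      exact hcon a hab'.1 b hab'.2 hab
    let f := LinearMap.toSpanSingleton R (R ⧸ I) (Submodule.Quotient.mk a)
    have hlt : I < LinearMap.ker f := by
      refine lt_of_le_of_ne (fun r hr => ?_) fun h => hb ?_
      · rw [LinearMap.mem_ker, LinearMap.toSpanSingleton_apply, ← Submodule.Quotient.mk_smul,
          Submodule.Quotient.mk_eq_zero]
        exact I.mul_mem_right _ hr
      · rw [h, LinearMap.mem_ker, LinearMap.toSpanSingleton_apply, ← Submodule.Quotient.mk_smul,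
          Submodule.Quotient.mk_eq_zero, smul_eq_mul, mul_comm]
        exact hab
    have hses : LinearMap.IsSES (LinearMap.range f).subtype (LinearMap.range f).mkQ :=
      ⟨Subtype.val_injective, LinearMap.exact_subtype_mkQ _, Submodule.mkQ_surjective _⟩
    refine hses.subsingleton_mid ?_ (hquot _ a ha (LinearMap.mem_range.2 ⟨1, by simp [f]⟩) i hi)
    exact Ext.subsingleton_of_linearEquiv f.quotKerEquivRange.symm (ih _ hlt i hi)

/-- Baer's criterion in terms of `Ext`. -/
lemma injective_of_subsingleton_ext_one {Y : ModuleCat.{u} R}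
    (h : ∀ I : Ideal R, Subsingleton (Ext (ModuleCat.of R (R ⧸ I)) Y 1)) : Injective Y := by
  have hB : Module.Baer R Y := by
    intro I g
    have hses : LinearMap.IsSES I.subtype I.mkQ :=
      ⟨Subtype.val_injective, LinearMap.exact_subtype_mkQ _, Submodule.mkQ_surjective _⟩
    obtain ⟨e, he⟩ := hses.exists_pull_left (Y := Y) (n := 0) (h I)
      (Ext.mk₀ (ModuleCat.ofHom g))
    obtain ⟨φ, rfl⟩ := (Ext.mk₀_bijective _ _).2 e
    rw [Ext.pull, Ext.mk₀_comp_mk₀] at he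
    have := (Ext.mk₀_bijective _ _).1 he
    refine ⟨φ.hom, fun x hx => ?_⟩
    exact ConcreteCategory.congr_hom this ⟨x, hx⟩
  have := hB.injective
  exact Module.injective_object_of_injective_module R Y

section resolution

variable {C : Type*} [Category* C] [Abelian C] {Z E : ℕ → C} (i : ∀ n, Z n ⟶ E n)
  (p : ∀ n, E n ⟶ Z (n + 1)) (w : ∀ n, i n ≫ p n = 0)

lemma exact_comp_of_shortExact (hS : ∀ n, (ShortComplex.mk (i n) (p n) (w n)).ShortExact) (n : ℕ) :
    (ShortComplex.mk (i n) (p n ≫ i (n + 1)) (by simp [reassoc_of% (w n)])).Exact := by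
  have := (hS (n + 1)).mono_f
  let α : ShortComplex.mk (i n) (p n) (w n) ⟶
      ShortComplex.mk (i n) (p n ≫ i (n + 1)) (by simp [reassoc_of% (w n)]) :=
    { τ₁ := 𝟙 _, τ₂ := 𝟙 _, τ₃ := i (n + 1) }
  have : Mono α.τ₃ := this
  rw [← ShortComplex.exact_iff_of_epi_of_isIso_of_mono α]
  exact (hS n).exact

lemma exact_comp_comp_of_shortExact (hS : ∀ n, (ShortComplex.mk (i n) (p n) (w n)).ShortExact)
    (n : ℕ) : (ShortComplex.mk (p n ≫ i (n + 1)) (p (n + 1) ≫ i (n + 2))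
      (by simp [reassoc_of% (w (n + 1))])).Exact := by
  have := (hS n).epi_g
  let α : ShortComplex.mk (p n ≫ i (n + 1)) (p (n + 1) ≫ i (n + 2))
      (by simp [reassoc_of% (w (n + 1))]) ⟶
      ShortComplex.mk (i (n + 1)) (p (n + 1) ≫ i (n + 2))
        (by simp [reassoc_of% (w (n + 1))]) :=
    { τ₁ := p n, τ₂ := 𝟙 _, τ₃ := 𝟙 _ }
  have : Epi α.τ₁ := this
  rw [ShortComplex.exact_iff_of_epi_of_isIso_of_mono α]
  exact exact_comp_of_shortExact i p w hS (n + 1)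

/-- The injective resolution obtained by splicing short exact sequences. -/
lemma exists_injectiveResolution_of_shortExact [∀ n, Injective (E n)]
    (hS : ∀ n, (ShortComplex.mk (i n) (p n) (w n)).ShortExact) :
    ∃ I : InjectiveResolution (Z 0), I.cocomplex.X = E := by
  let K : CochainComplex C ℕ := CochainComplex.of E (fun n => p n ≫ i (n + 1))
    (fun n => by simp [reassoc_of% (w (n + 1))])
  have hd : ∀ n, K.d n (n + 1) = p n ≫ i (n + 1) := fun n => CochainComplex.of_d E (fun n => p n ≫ i (n + 1)) n
  have := (hS 0).mono_f
  refine ⟨{ cocomplex := K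
            injective := fun n => inferInstanceAs (Injective (E n))
            ι := (CochainComplex.fromSingle₀Equiv _ _).symm ⟨i 0, by
              rw [hd]; simp [reassoc_of% (w 0)]⟩
            quasiIso := ⟨fun n => ?_⟩ }, rfl⟩
  cases n with
  | zero =>
    rw [CochainComplex.quasiIsoAt₀_iff, ShortComplex.quasiIso_iff_of_zeros]
    · refine (ShortComplex.exact_and_mono_f_iff_of_iso ?_).2
        ⟨exact_comp_of_shortExact i p w hS 0, this⟩
      exact ShortComplex.isoMk (Iso.refl _) (Iso.refl _) (Iso.refl _)
        (by simp only [HomologicalComplex.shortComplexFunctor'_map_τ₂,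
              CochainComplex.fromSingle₀Equiv_symm_apply_f_zero]
            exact (Category.id_comp _).trans (Category.comp_id _).symm)
        ((Category.id_comp _).trans ((hd 0).symm.trans (Category.comp_id _).symm))
    all_goals rfl
  | succ n =>
    rw [quasiIsoAt_iff_exactAt]
    · rw [HomologicalComplex.exactAt_iff' _ n (n + 1) (n + 1 + 1) (by simp) (by simp)]
      refine (ShortComplex.exact_iff_of_iso ?_).2 (exact_comp_comp_of_shortExact i p w hS n)
      exact ShortComplex.isoMk (Iso.refl _) (Iso.refl _) (Iso.refl _)
        ((Category.id_comp _).trans ((hd n).symm.trans (Category.comp_id _).symm))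
        ((Category.id_comp _).trans ((hd (n + 1)).symm.trans (Category.comp_id _).symm))
    · apply CochainComplex.exactAt_succ_single_obj

end resolution

end

section

variable {R : Type u} [CommRing R]

lemma ModuleCat.exists_injective_embedding (Z : ModuleCat.{u} R) :
    ∃ (J : ModuleCat.{u} R) (f : Z →ₗ[R] J), Injective J ∧ Function.Injective f ∧
      (Injective Z → Function.Surjective f) := by
  by_cases hZ : Injective Z
  · exact ⟨Z, LinearMap.id, hZ, Function.injective_id, fun _ => Function.surjective_id⟩
  · exact ⟨Injective.under Z, (Injective.ι Z).hom, inferInstance,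
      (ModuleCat.mono_iff_injective _).1 inferInstance, fun h => absurd h hZ⟩

/-- An injective module containing `Z`, equal to `Z` if `Z` is injective. -/
noncomputable def ModuleCat.envelope (Z : ModuleCat.{u} R) : ModuleCat.{u} R :=
  Z.exists_injective_embedding.choose

/-- The embedding of `Z` into the injective module `Z.envelope`. -/
noncomputable def ModuleCat.toEnvelope (Z : ModuleCat.{u} R) : Z →ₗ[R] Z.envelope :=
  Z.exists_injective_embedding.choose_spec.choose

instance (Z : ModuleCat.{u} R) : Injective Z.envelope :=
  Z.exists_injective_embedding.choose_spec.choose_spec.1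

instance (Z : ModuleCat.{u} R) : Injective (ModuleCat.of R Z.envelope) :=
  inferInstanceAs (Injective Z.envelope)

lemma ModuleCat.toEnvelope_injective (Z : ModuleCat.{u} R) : Function.Injective Z.toEnvelope :=
  Z.exists_injective_embedding.choose_spec.choose_spec.2.1

lemma ModuleCat.toEnvelope_surjective (Z : ModuleCat.{u} R) [h : Injective Z] :
    Function.Surjective Z.toEnvelope :=
  Z.exists_injective_embedding.choose_spec.choose_spec.2.2 h

/-- The cosyzygies of a module. -/
noncomputable def ModuleCat.cosyz (Z : ModuleCat.{u} R) : ℕ → ModuleCat.{u} R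
  | 0 => Z
  | n + 1 => ModuleCat.of R ((Z.cosyz n).envelope ⧸ LinearMap.range (Z.cosyz n).toEnvelope)

/-- The projection of an injective envelope onto the next cosyzygy. -/
noncomputable def ModuleCat.toCosyz (Z : ModuleCat.{u} R) (n : ℕ) :
    (Z.cosyz n).envelope →ₗ[R] Z.cosyz (n + 1) :=
  (LinearMap.range (Z.cosyz n).toEnvelope).mkQ

lemma ModuleCat.isSES_cosyz (Z : ModuleCat.{u} R) (n : ℕ) :
    LinearMap.IsSES (Z.cosyz n).toEnvelope (Z.toCosyz n) :=
  LinearMap.isSES_range (Z.cosyz n).toEnvelope_injective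

section covariant

variable {A B C : Type u} [AddCommGroup A] [Module R A] [AddCommGroup B] [Module R B]
  [AddCommGroup C] [Module R C] {f : A →ₗ[R] B} {g : B →ₗ[R] C} {n : ℕ}

lemma LinearMap.IsSES.subsingleton_ext_right (h : LinearMap.IsSES f g)
    {X : ModuleCat.{u} R} (hA : Subsingleton (Ext X (ModuleCat.of R A) (n + 1)))
    (hB : Subsingleton (Ext X (ModuleCat.of R B) n)) :
    Subsingleton (Ext X (ModuleCat.of R C) n) :=
  subsingleton_of_forall_eq 0 fun e => by
    obtain ⟨e', rfl⟩ := Ext.covariant_sequence_exact₃ X h.shortExact e rfl (hA.elim _ _)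
    rw [hB.elim e' 0]
    exact Ext.zero_comp ..

end covariant

lemma ModuleCat.injective_cosyz {Z : ModuleCat.{u} R} {t : ℕ}
    (h : ∀ (I : Ideal R) i, t ≤ i → Subsingleton (Ext (ModuleCat.of R (R ⧸ I)) Z i)) :
    Injective (Z.cosyz t) := by
  have key : ∀ (j : ℕ) (I : Ideal R) (i : ℕ), t ≤ i + 1 + j →
      Subsingleton (Ext (ModuleCat.of R (R ⧸ I)) (Z.cosyz j) (i + 1)) := by
    intro j
    induction j with
    | zero => exact fun I i hi => h I _ hi
    | succ j ih =>
      intro I i hi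
      exact (Z.isSES_cosyz j).subsingleton_ext_right (ih I (i + 1) (by omega))
        (subsingleton_of_forall_eq 0 fun e => Ext.eq_zero_of_injective e)
  exact injective_of_subsingleton_ext_one fun I => key t I 0 (by omega)

lemma ModuleCat.subsingleton_envelope_cosyz {Z : ModuleCat.{u} R} {t : ℕ}
    (h : Injective (Z.cosyz t)) {n : ℕ} (hn : t < n) : Subsingleton (Z.cosyz n).envelope := by
  have key : ∀ Y : ModuleCat.{u} R, Injective Y →
      Subsingleton (Y.envelope ⧸ LinearMap.range Y.toEnvelope) := fun Y _ =>
    Submodule.Quotient.subsingleton_iff.2 (LinearMap.range_eq_top.2 Y.toEnvelope_surjective)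
  have hz : Subsingleton (Z.cosyz n) := by
    induction n, hn using Nat.le_induction with
    | base => exact key _ h
    | succ n _ ih =>
      exact key _ ((ModuleCat.isZero_of_subsingleton _).injective)
  have : Injective (Z.cosyz n) := (ModuleCat.isZero_of_subsingleton _).injective
  exact (Z.cosyz n).toEnvelope_surjective.subsingleton

lemma exists_hasInjDimLT_of_subsingleton_ext {M : Type u} [AddCommGroup M]
    [Module R M] {t : ℕ}
    (h : ∀ (I : Ideal R) i, t ≤ i →
      Subsingleton (Ext (ModuleCat.of R (R ⧸ I)) (ModuleCat.of R M) i)) :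
    HasInjDimLT R M (t + 1) := by
  obtain ⟨I, hI⟩ := exists_injectiveResolution_of_shortExact
    (Z := (ModuleCat.of R M).cosyz) (E := fun n => ((ModuleCat.of R M).cosyz n).envelope)
    (fun n => ModuleCat.ofHom ((ModuleCat.of R M).cosyz n).toEnvelope)
    (fun n => ModuleCat.ofHom ((ModuleCat.of R M).toCosyz n)) _
    (fun n => ((ModuleCat.of R M).isSES_cosyz n).shortExact)
  refine ⟨I, fun i hi => ?_⟩
  have := ModuleCat.subsingleton_envelope_cosyz (ModuleCat.injective_cosyz h) hi
  rw [hI]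
  exact ModuleCat.isZero_of_subsingleton _

end

section

variable {R : Type u} [CommRing R]

lemma LinearMap.exists_comp_eq_of_injective {A B I : Type u} [AddCommGroup A] [Module R A]
    [AddCommGroup B] [Module R B] [AddCommGroup I] [Module R I] [Injective (ModuleCat.of R I)]
    (φ : A →ₗ[R] B) (ψ : A →ₗ[R] I) (h : LinearMap.ker φ ≤ LinearMap.ker ψ) :
    ∃ g : B →ₗ[R] I, g ∘ₗ φ = ψ := by
  have := Module.injective_module_of_injective_object R I
  obtain ⟨g, hg⟩ := Module.Injective.out ((LinearMap.ker φ).liftQ φ le_rfl)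
    (LinearMap.ker_eq_bot.1 (Submodule.ker_liftQ_eq_bot _ _ _ le_rfl))
    ((LinearMap.ker φ).liftQ ψ h)
  exact ⟨g, LinearMap.ext fun a => hg (Submodule.Quotient.mk a)⟩

section powTors

variable {A B : Type u} [AddCommGroup A] [Module R A] [AddCommGroup B] [Module R B]

variable (A) in
/-- The submodule of elements annihilated by a power of each element of `s`. -/
def powTors (s : Set R) : Submodule R A where
  carrier := {e | ∀ x ∈ s, ∃ n : ℕ, x ^ n • e = 0}
  zero_mem' := fun x _ => ⟨0, smul_zero _⟩
  add_mem' := by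
    intro a b ha hb x hx
    obtain ⟨n, hn⟩ := ha x hx
    obtain ⟨m, hm⟩ := hb x hx
    refine ⟨n + m, ?_⟩
    rw [smul_add, pow_add, mul_smul _ _ b, hm, mul_comm, mul_smul, hn, smul_zero, smul_zero,
      add_zero]
  smul_mem' := by
    intro c a ha x hx
    obtain ⟨n, hn⟩ := ha x hx
    exact ⟨n, by rw [smul_comm, hn, smul_zero]⟩

lemma powTors_map_mem (f : A →ₗ[R] B) {s : Set R} {a : A} (ha : a ∈ powTors A s) :
    f a ∈ powTors B s := fun x hx => by
  obtain ⟨n, hn⟩ := ha x hx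
  exact ⟨n, by rw [← map_smul, hn, map_zero]⟩

lemma powTors_mem_of_injective {f : A →ₗ[R] B} (hf : Function.Injective f) {s : Set R} {a : A}
    (ha : f a ∈ powTors B s) : a ∈ powTors A s := fun x hx => by
  obtain ⟨n, hn⟩ := ha x hx
  exact ⟨n, hf (by rw [map_smul, hn, map_zero])⟩

lemma powTors_anti {s t : Set R} (h : s ⊆ t) : powTors A t ≤ powTors A s :=
  fun _ ha x hx => ha x (h hx)

lemma powTors_span (s : Set R) : powTors A (Ideal.span s : Set R) = powTors A s := by
  refine le_antisymm (powTors_anti Ideal.subset_span) fun a ha => ?_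
  have h : Ideal.span s ≤ (Ideal.torsionOf R A a).radical := by
    refine Ideal.span_le.2 fun x hx => ?_
    obtain ⟨n, hn⟩ := ha x hx
    exact ⟨n, hn⟩
  exact fun x hx => h hx

lemma Ext.subsingleton_of_subsingleton [Subsingleton A] {Y : ModuleCat.{u} R} {n : ℕ} :
    Subsingleton (Ext (ModuleCat.of R A) Y n) :=
  subsingleton_of_forall_eq 0 fun e => by
    rw [← Ext.pull_id e, Subsingleton.elim LinearMap.id ((0 : R) • LinearMap.id : A →ₗ[R] A),
      Ext.pull_smul_id, zero_smul]

lemma exists_smul_sub_mem_powTors [IsNoetherianRing R] [Injective (ModuleCat.of R A)] {s : Set R}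
    {a : A} (ha : a ∈ powTors A s) (x : R) :
    ∃ b ∈ powTors A s, ∃ n : ℕ, x ^ n • (x • b - a) = 0 := by
  obtain ⟨n, hn⟩ := monotone_stabilizes_iff_noetherian.2 ‹IsNoetherianRing R›
    ⟨fun n => LinearMap.ker (LinearMap.toSpanSingleton R A (x ^ n • a)),
      monotone_nat_of_le_succ fun n r hr => by
        rw [LinearMap.mem_ker, LinearMap.toSpanSingleton_apply] at hr ⊢
        rw [pow_succ', mul_smul, smul_comm, hr, smul_zero]⟩
  obtain ⟨g, hg⟩ := LinearMap.exists_comp_eq_of_injective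
    (LinearMap.toSpanSingleton R A (x ^ (n + 1) • a)) (LinearMap.toSpanSingleton R A (x ^ n • a))
    (hn (n + 1) (Nat.le_succ n)).ge
  refine ⟨g a, powTors_map_mem g ha, n, ?_⟩
  have := LinearMap.congr_fun hg 1
  simp only [LinearMap.comp_apply, LinearMap.toSpanSingleton_apply, one_smul, map_smul] at this
  rw [smul_sub, smul_smul, ← pow_succ, this, sub_self]

lemma Ext.subsingleton_quotient_powTors_finset [IsNoetherianRing R] [Injective (ModuleCat.of R A)]
    (s : Finset R) {m : ℕ} (hs : ∀ x ∈ s, ∀ b : B, x ^ m • b = 0) (n : ℕ) :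
    Subsingleton (Ext (ModuleCat.of R (A ⧸ powTors A (s : Set R))) (ModuleCat.of R B) n) := by
  classical
  induction s using Finset.induction_on with
  | empty =>
    have : Subsingleton (A ⧸ powTors A ((∅ : Finset R) : Set R)) :=
      Submodule.Quotient.subsingleton_iff.2 (eq_top_iff.2 fun a _ x hx => by simp at hx)
    exact Ext.subsingleton_of_subsingleton
  | insert x s hxs ih =>
    have hle : powTors A ((insert x s : Finset R) : Set R) ≤ powTors A (s : Set R) :=
      powTors_anti (by simp)
    have hsurj := Submodule.factor_surjective hle
    refine (LinearMap.isSES_ker hsurj).subsingleton_mid ?_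
      (ih fun y hy => hs y (Finset.mem_insert_of_mem hy))
    have hmem : ∀ a : A, (∀ y ∈ s, ∃ n : ℕ, y ^ n • a = 0) → (∃ n : ℕ, x ^ n • a = 0) →
        a ∈ powTors A ((insert x s : Finset R) : Set R) := by
      intro a h1 h2 y hy
      rcases Finset.mem_insert.1 (Finset.mem_coe.1 hy) with rfl | hy
      exacts [h2, h1 y hy]
    refine Ext.subsingleton_of_bijective_smul (r := x) ⟨?_, ?_⟩
      (hs x (Finset.mem_insert_self _ _))
    · refine (injective_iff_map_eq_zero (DistribSMul.toAddMonoidHom _ x)).2 ?_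
      rintro ⟨w, hw⟩ h
      obtain ⟨a, rfl⟩ := Submodule.Quotient.mk_surjective _ w
      have ha : a ∈ powTors A (s : Set R) := (Submodule.Quotient.mk_eq_zero _).1 hw
      have h' : Submodule.Quotient.mk (x • a) =
          (0 : A ⧸ powTors A ((insert x s : Finset R) : Set R)) := congrArg Subtype.val h
      obtain ⟨n, hn⟩ := (Submodule.Quotient.mk_eq_zero _).1 h' x (by simp)
      refine Subtype.ext ((Submodule.Quotient.mk_eq_zero _).2 (hmem a ha ⟨n + 1, ?_⟩))
      rw [pow_succ, mul_smul, hn]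
    · rintro ⟨w, hw⟩
      obtain ⟨a, rfl⟩ := Submodule.Quotient.mk_surjective _ w
      have ha : a ∈ powTors A (s : Set R) := (Submodule.Quotient.mk_eq_zero _).1 hw
      obtain ⟨b, hb, n, hn⟩ := exists_smul_sub_mem_powTors ha x
      refine ⟨⟨Submodule.Quotient.mk b, (Submodule.Quotient.mk_eq_zero _).2 hb⟩, Subtype.ext ?_⟩
      refine (Submodule.Quotient.eq _).2 (hmem _ ?_ ⟨n, hn⟩)
      exact sub_mem ((powTors A (s : Set R)).smul_mem x hb) ha

lemma Ext.subsingleton_quotient_powTors [IsNoetherianRing R] [Injective (ModuleCat.of R A)]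
    (J : Ideal R) {m : ℕ} (hJ : ∀ x ∈ J, ∀ b : B, x ^ m • b = 0) (n : ℕ) :
    Subsingleton (Ext (ModuleCat.of R (A ⧸ powTors A (J : Set R))) (ModuleCat.of R B) n) := by
  obtain ⟨s, rfl⟩ := IsNoetherian.noetherian J
  change Subsingleton (Ext (ModuleCat.of R (A ⧸ powTors A (Ideal.span (s : Set R) : Set R))) _ n)
  rw [powTors_span]
  exact Ext.subsingleton_quotient_powTors_finset s (fun x hx => hJ x (Ideal.subset_span hx)) n

end powTors

end

section

variable {R : Type u} [CommRing R]

section lift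

variable {A I C T : Type u} [AddCommGroup A] [Module R A] [AddCommGroup I] [Module R I]
  [AddCommGroup C] [Module R C] [AddCommGroup T] [Module R T] {f : A →ₗ[R] I} {g : I →ₗ[R] C}

lemma LinearMap.IsSES.exists_lift (h : LinearMap.IsSES f g)
    (hT : Subsingleton (Ext (ModuleCat.of R T) (ModuleCat.of R A) 1)) (φ : T →ₗ[R] C) :
    ∃ ψ : T →ₗ[R] I, g ∘ₗ ψ = φ := by
  obtain ⟨e, he⟩ := Ext.covariant_sequence_exact₃ _ h.shortExact (Ext.mk₀ (ModuleCat.ofHom φ)) rfl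
    (hT.elim _ _)
  obtain ⟨ψ, rfl⟩ := (Ext.mk₀_bijective _ _).2 e
  rw [Ext.mk₀_comp_mk₀] at he
  exact ⟨ψ.hom, congrArg ModuleCat.Hom.hom ((Ext.mk₀_bijective _ _).1 he)⟩

lemma LinearMap.IsSES.subsingleton_ext_one_of_lift [Injective (ModuleCat.of R I)]
    (h : LinearMap.IsSES f g) (hT : ∀ φ : T →ₗ[R] C, ∃ ψ : T →ₗ[R] I, g ∘ₗ ψ = φ) :
    Subsingleton (Ext (ModuleCat.of R T) (ModuleCat.of R A) 1) :=
  subsingleton_of_forall_eq 0 fun e => by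
    obtain ⟨e', rfl⟩ := Ext.covariant_sequence_exact₁ _ h.shortExact e
      (Ext.eq_zero_of_injective (I := ModuleCat.of R I) _) (zero_add 1)
    obtain ⟨φ, rfl⟩ := (Ext.mk₀_bijective _ _).2 e'
    obtain ⟨ψ, hψ⟩ := hT φ.hom
    have hφ : φ = ModuleCat.ofHom ψ ≫ ModuleCat.ofHom g := by
      ext x
      exact (LinearMap.congr_fun hψ x).symm
    rw [hφ, ← Ext.mk₀_comp_mk₀, Ext.comp_assoc _ _ _ (zero_add 0) (zero_add 1) (by omega)]
    erw [h.shortExact.comp_extClass]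
    exact Ext.comp_zero ..

lemma exists_notMem_smul_mem [IsNoetherianRing R] [IsLocalRing R]
    (hT : powTors T (maximalIdeal R : Set R) = ⊤) {D : Submodule R T} (hD : D ≠ ⊤) :
    ∃ p ∉ D, ∀ r ∈ maximalIdeal R, r • p ∈ D := by
  have : Nontrivial (T ⧸ D) := Submodule.Quotient.nontrivial_iff.2 hD
  obtain ⟨P, hP⟩ := associatedPrimes.nonempty R (T ⧸ D)
  rw [AssociatedPrimes.mem_iff, isAssociatedPrime_iff] at hP
  obtain ⟨hp, x, rfl⟩ := hP
  obtain ⟨p, rfl⟩ := Submodule.Quotient.mk_surjective _ x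
  have key : ∀ r : R, r ∈ (⊥ : Submodule R (T ⧸ D)).colon {Submodule.Quotient.mk p} ↔
      r • p ∈ D := fun r => by
    rw [Submodule.mem_colon_singleton, Submodule.mem_bot, ← Submodule.Quotient.mk_smul,
      Submodule.Quotient.mk_eq_zero]
  refine ⟨p, fun hpD => hp.ne_top ?_, fun r hr => ?_⟩
  · rw [Ideal.eq_top_iff_one, key]
    simpa using hpD
  · obtain ⟨n, hn⟩ := (hT.ge trivial : p ∈ powTors T _) r hr
    rw [← key]
    refine hp.mem_of_pow_mem n ((key _).2 ?_)
    rw [hn]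
    exact D.zero_mem

lemma LinearMap.IsSES.exists_lift_of_powTors [IsNoetherianRing R] [IsLocalRing R]
    [Injective (ModuleCat.of R I)] (h : LinearMap.IsSES f g)
    (hk : Subsingleton (Ext (ModuleCat.of R (R ⧸ maximalIdeal R)) (ModuleCat.of R A) 1))
    (hT : powTors T (maximalIdeal R : Set R) = ⊤) (φ : T →ₗ[R] C) :
    ∃ ψ : T →ₗ[R] I, g ∘ₗ ψ = φ := by
  obtain ⟨m, -, hm, hmax⟩ := zorn_le_nonempty₀
    {q : T →ₗ.[R] I | ∀ x : q.domain, g (q x) = φ x} (by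
      intro c hc hchain y hy
      have hdir : DirectedOn (· ≤ ·) c := hchain.directedOn
      refine ⟨LinearPMap.sSup c hdir, fun x => ?_, fun q hq => LinearPMap.le_sSup hdir hq⟩
      obtain ⟨q, hq, hx⟩ := (LinearPMap.mem_domain_sSup_iff ⟨y, hy⟩ hdir).1 x.2
      rw [← (LinearPMap.le_sSup hdir hq).2 (x := ⟨x, hx⟩) (y := x) rfl]
      exact hc hq ⟨x, hx⟩)
    ⊥ (by
      intro x
      have hx := (Submodule.mem_bot R).1 x.2
      have : x = 0 := Subtype.ext hx
      subst this
      simp)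
  obtain ⟨ψ, hψ⟩ := LinearMap.exists_comp_eq_of_injective m.domain.subtype m.toFun (by simp)
  have hψm : ∀ x : m.domain, ψ x = m x := fun x => LinearMap.congr_fun hψ x
  by_cases hD : m.domain = ⊤
  · refine ⟨ψ, LinearMap.ext fun x => ?_⟩
    have := hm ⟨x, hD ▸ trivial⟩
    rw [← hψm] at this
    exact this
  exfalso
  obtain ⟨p, hp, hpD⟩ := exists_notMem_smul_mem hT hD
  have hδ : ∀ x ∈ m.domain, g (ψ x) - φ x = 0 := fun x hx => by
    rw [sub_eq_zero, hψm ⟨x, hx⟩]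
    exact hm ⟨x, hx⟩
  obtain ⟨θ, hθ⟩ := h.exists_lift hk (socleMap (g (ψ p) - φ p) fun r hr => by
    rw [smul_sub, ← map_smul, ← map_smul, ← map_smul]
    exact hδ _ (hpD r hr))
  have hθ1 := LinearMap.congr_fun hθ (Submodule.Quotient.mk 1)
  rw [LinearMap.comp_apply, socleMap_one] at hθ1
  obtain ⟨l, hl⟩ := LinearMap.exists_comp_eq_of_injective
    (LinearMap.toSpanSingleton R (T ⧸ m.domain) (Submodule.Quotient.mk p))
    (LinearMap.toSpanSingleton R I (θ (Submodule.Quotient.mk 1))) (by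
      intro r hr
      refine smul_residue_hom_one θ ((IsLocalRing.mem_maximalIdeal r).2 fun hu => hp ?_)
      rw [LinearMap.mem_ker, LinearMap.toSpanSingleton_apply, ← Submodule.Quotient.mk_smul,
        Submodule.Quotient.mk_eq_zero] at hr
      exact (Submodule.smul_mem_iff_of_isUnit _ hu).1 hr)
  have hl1 := LinearMap.congr_fun hl 1
  simp only [LinearMap.comp_apply, LinearMap.toSpanSingleton_apply, one_smul] at hl1
  let ψ' : T →ₗ[R] I := ψ - l ∘ₗ m.domain.mkQ
  let D := LinearMap.eqLocus (g ∘ₗ ψ') φ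
  have hψ' : ∀ x : m.domain, ψ' x = m x := fun x => by
    simp [ψ', hψm, (Submodule.Quotient.mk_eq_zero m.domain).2 x.2]
  have hmD : m ≤ ⟨D, ψ' ∘ₗ D.subtype⟩ := by
    refine ⟨fun x hx => ?_, fun x y hxy => ?_⟩
    · change g (ψ' x) = φ x
      rw [hψ' ⟨x, hx⟩]
      exact hm ⟨x, hx⟩
    · rw [← hψ' x, hxy]
      rfl
  have hD' : (⟨D, ψ' ∘ₗ D.subtype⟩ : T →ₗ.[R] I) ∈
      {q : T →ₗ.[R] I | ∀ x : q.domain, g (q x) = φ x} := fun x => x.2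
  refine hp ((hmax hD' hmD).1 ?_)
  change g (ψ' p) = φ p
  simp only [ψ', LinearMap.sub_apply, LinearMap.comp_apply, Submodule.mkQ_apply, hl1, map_sub, hθ1]
  abel

end lift

lemma Ext.subsingleton_of_powTors [IsNoetherianRing R] [IsLocalRing R] {T : Type u}
    [AddCommGroup T] [Module R T] (hT : powTors T (maximalIdeal R : Set R) = ⊤) (n : ℕ)
    (M : ModuleCat.{u} R)
    (hk : Subsingleton (Ext (ModuleCat.of R (R ⧸ maximalIdeal R)) M (n + 1))) :
    Subsingleton (Ext (ModuleCat.of R T) M (n + 1)) := by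
  induction n generalizing M with
  | zero =>
    exact (M.isSES_cosyz 0).subsingleton_ext_one_of_lift
      ((M.isSES_cosyz 0).exists_lift_of_powTors hk hT)
  | succ n ih =>
    have := ih (M.cosyz 1) ((M.isSES_cosyz 0).subsingleton_ext_right hk
      (subsingleton_of_forall_eq 0 fun e =>
        Ext.eq_zero_of_injective (I := ModuleCat.of R (M.cosyz 0).envelope) e))
    refine subsingleton_of_forall_eq 0 fun e => ?_
    obtain ⟨e', rfl⟩ := Ext.covariant_sequence_exact₁ _ (M.isSES_cosyz 0).shortExact e
      (Ext.eq_zero_of_injective (I := ModuleCat.of R (M.cosyz 0).envelope) _) rfl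
    rw [this.elim e' 0]
    exact Ext.zero_comp ..

end

section

variable {R : Type u} [CommRing R] (M : ModuleCat.{u} R)

/-- The class of the exact sequence `0 → M → E⁰ → ⋯ → Eⁿ⁻¹ → Zⁿ → 0`. -/
noncomputable def ModuleCat.cosyzClass : ∀ n, Ext (ModuleCat.of R (M.cosyz n)) M n
  | 0 => Ext.mk₀ (𝟙 M)
  | n + 1 => (M.isSES_cosyz n).shortExact.extClass.comp (cosyzClass n) (add_comm 1 n)

lemma ModuleCat.exists_comp_cosyzClass {X : ModuleCat.{u} R} (i : ℕ) {j n : ℕ} (h : j + i = n)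
    (e : Ext X M n) :
    ∃ e' : Ext X (ModuleCat.of R (M.cosyz i)) j, e'.comp (M.cosyzClass i) h = e := by
  induction i generalizing j n with
  | zero =>
    obtain rfl : j = n := by simpa using h
    exact ⟨e, Ext.comp_mk₀_id e⟩
  | succ i ih =>
    obtain ⟨e', rfl⟩ := ih (j := j + 1) (by omega) e
    obtain ⟨e'', rfl⟩ := Ext.covariant_sequence_exact₁ _ (M.isSES_cosyz i).shortExact e'
      (Ext.eq_zero_of_injective (I := ModuleCat.of R (M.cosyz i).envelope) _) rfl
    exact ⟨e'', (Ext.comp_assoc _ _ _ _ _ (by omega)).symm⟩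

lemma ModuleCat.pull_toCosyz_cosyzClass (n : ℕ) :
    Ext.pull (M.toCosyz n) (M.cosyzClass (n + 1)) = 0 :=
  (M.isSES_cosyz n).shortExact.comp_extClass_assoc ..

lemma ModuleCat.exists_pull_cosyzClass {X : Type u} [AddCommGroup X] [Module R X] {n : ℕ}
    (e : Ext (ModuleCat.of R X) M n) :
    ∃ φ : X →ₗ[R] M.cosyz n, Ext.pull φ (M.cosyzClass n) = e := by
  obtain ⟨e', rfl⟩ := M.exists_comp_cosyzClass n (zero_add n) e
  obtain ⟨φ, rfl⟩ := (Ext.mk₀_bijective _ _).2 e'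
  exact ⟨φ.hom, rfl⟩

section tors

variable [IsLocalRing R]

/-- The image in a cosyzygy of the `𝔪`-torsion of the preceding injective module. -/
noncomputable def ModuleCat.cosyzTors (n : ℕ) : Submodule R (M.cosyz (n + 1)) :=
  (powTors (M.cosyz n).envelope (maximalIdeal R : Set R)).map (M.toCosyz n)

lemma ModuleCat.notMem_cosyzTors [IsNoetherianRing R] {n : ℕ}
    (hk : Subsingleton (Ext (ModuleCat.of R (R ⧸ maximalIdeal R)) M (n + 1)))
    {ξ : (R ⧸ maximalIdeal R) →ₗ[R] M.cosyz (n + 2)}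
    (hξ : Ext.pull ξ (M.cosyzClass (n + 2)) ≠ 0) :
    ξ (Submodule.Quotient.mk 1) ∉ M.cosyzTors (n + 1) := by
  rintro ⟨c, hc, hcξ⟩
  let E := (M.cosyz (n + 1)).envelope
  let Γ := powTors E (maximalIdeal R : Set R)
  let P : Submodule R (E × (R ⧸ maximalIdeal R)) :=
    Γ.comap (LinearMap.fst R _ _) ⊓
      LinearMap.eqLocus (M.toCosyz (n + 1) ∘ₗ LinearMap.fst R E (R ⧸ maximalIdeal R))
        (ξ ∘ₗ LinearMap.snd R E (R ⧸ maximalIdeal R))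
  let p : P →ₗ[R] R ⧸ maximalIdeal R := LinearMap.snd R _ _ ∘ₗ P.subtype
  let q : P →ₗ[R] E := LinearMap.fst R _ _ ∘ₗ P.subtype
  have hpq : ξ ∘ₗ p = M.toCosyz (n + 1) ∘ₗ q := LinearMap.ext fun x => x.2.2.symm
  have hp : Function.Surjective p := by
    intro a
    obtain ⟨r, rfl⟩ := Submodule.Quotient.mk_surjective _ a
    have hr : (Submodule.Quotient.mk r : R ⧸ maximalIdeal R) = r • Submodule.Quotient.mk 1 := by
      rw [← Submodule.Quotient.mk_smul, smul_eq_mul, mul_one]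
    refine ⟨⟨(r • c, Submodule.Quotient.mk r), Γ.smul_mem r hc, ?_⟩, rfl⟩
    change M.toCosyz (n + 1) (r • c) = ξ (Submodule.Quotient.mk r)
    rw [hr, map_smul, map_smul, hcξ]
  have hker : powTors (LinearMap.ker p) (maximalIdeal R : Set R) = ⊤ := by
    refine eq_top_iff.2 fun x _ => ?_
    refine powTors_mem_of_injective (f := q ∘ₗ (LinearMap.ker p).subtype) ?_
      (show q x.1 ∈ Γ from x.1.2.1)
    rintro ⟨x, hx⟩ ⟨y, hy⟩ hxy
    exact Subtype.ext (Subtype.ext (Prod.ext hxy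
      ((LinearMap.mem_ker.1 hx).trans (LinearMap.mem_ker.1 hy).symm)))
  refine hξ ((LinearMap.isSES_ker hp).eq_zero_of_pull_right
    (Ext.subsingleton_of_powTors hker n M hk) _ ?_)
  rw [Ext.pull_pull, hpq, ← Ext.pull_pull, M.pull_toCosyz_cosyzClass, Ext.pull_zero]

end tors

end

section

variable {R : Type u} [CommRing R] [IsNoetherianRing R]

lemma LinearMap.exists_mem_smul_top_of_range_le {X M : Type u} [AddCommGroup X] [Module R X]
    [Module.Finite R X] [AddCommGroup M] [Module R M] [Module.Finite R M] (I : Ideal R) :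
    ∃ n : ℕ, ∀ f : X →ₗ[R] M, LinearMap.range f ≤ I ^ n • (⊤ : Submodule R M) →
      f ∈ I • (⊤ : Submodule R (X →ₗ[R] M)) := by
  obtain ⟨b, π, hπ⟩ := Module.Finite.exists_fin' R X
  let Φ : (X →ₗ[R] M) →ₗ[R] (Fin b → M) :=
    LinearMap.pi fun i => LinearMap.applyₗ (π (Pi.single i 1))
  have hΦ : Function.Injective Φ := by
    intro f g hfg
    have : f ∘ₗ π = g ∘ₗ π := LinearMap.pi_ext' fun i => LinearMap.ext_ring (congrFun hfg i)
    exact LinearMap.ext fun x => by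
      obtain ⟨y, rfl⟩ := hπ x
      exact LinearMap.congr_fun this y
  obtain ⟨k, hk⟩ := Ideal.exists_pow_inf_eq_pow_smul I (LinearMap.range Φ)
  refine ⟨k + 1, fun f hf => ?_⟩
  have h1 : Φ f ∈ I ^ (k + 1) • (⊤ : Submodule R (Fin b → M)) := by
    rw [← Finset.univ_sum_single (Φ f)]
    refine Submodule.sum_mem _ fun i _ => ?_
    have h2 : Φ f i ∈ I ^ (k + 1) • (⊤ : Submodule R M) := hf ⟨_, rfl⟩
    have h3 := Submodule.mem_map_of_mem (f := LinearMap.single R (fun _ : Fin b => M) i) h2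
    rw [Submodule.map_smul''] at h3
    exact Submodule.smul_mono le_rfl le_top h3
  have h2 : Φ f ∈ I • LinearMap.range Φ := by
    have h3 : Φ f ∈ I ^ (k + 1) • (⊤ : Submodule R (Fin b → M)) ⊓ LinearMap.range Φ :=
      ⟨h1, f, rfl⟩
    rw [hk (k + 1) (Nat.le_succ k), Nat.add_sub_cancel_left, pow_one] at h3
    exact Submodule.smul_mono le_rfl inf_le_right h3
  rw [← Submodule.map_top, ← Submodule.map_smul''] at h2
  obtain ⟨g, hg, hgf⟩ := h2
  exact hΦ hgf ▸ hg

lemma Ext.exists_mem_smul_top {X M : Type u} [AddCommGroup X] [Module R X]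
    [Module.Finite R X] [AddCommGroup M] [Module R M] [Module.Finite R M] (I : Ideal R) (r : ℕ) :
    ∃ n : ℕ, ∀ e : Ext (ModuleCat.of R X)
        (ModuleCat.of R ↥(I ^ n • (⊤ : Submodule R M))) r,
      e.comp (Ext.mk₀ (ModuleCat.ofHom (Submodule.subtype _))) (add_zero r) ∈
        I • (⊤ : Submodule R (Ext (ModuleCat.of R X) (ModuleCat.of R M) r)) := by
  induction r generalizing X with
  | zero =>
    obtain ⟨n, hn⟩ := LinearMap.exists_mem_smul_top_of_range_le (X := X) (M := M) I
    refine ⟨n, fun e => ?_⟩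
    obtain ⟨φ, rfl⟩ := (Ext.mk₀_bijective _ _).2 e
    let L : (X →ₗ[R] M) →ₗ[R] Ext (ModuleCat.of R X) (ModuleCat.of R M) 0 :=
      { toFun f := Ext.mk₀ (ModuleCat.ofHom f)
        map_add' f g := Ext.mk₀_add (ModuleCat.ofHom f) (ModuleCat.ofHom g)
        map_smul' c f := Ext.mk₀_smul c (ModuleCat.ofHom f) }
    have h := Submodule.mem_map_of_mem (f := L) (hn (Submodule.subtype _ ∘ₗ φ.hom) (by
      rintro _ ⟨x, rfl⟩
      exact (φ.hom x).2))
    rw [Submodule.map_smul''] at h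
    rw [Ext.mk₀_comp_mk₀]
    exact Submodule.smul_mono le_rfl le_top h
  | succ r ih =>
    obtain ⟨b, π, hπ⟩ := Module.Finite.exists_fin' R X
    have hses := LinearMap.isSES_ker hπ
    obtain ⟨n, hn⟩ := ih (X := LinearMap.ker π)
    refine ⟨n, fun e => ?_⟩
    have : Projective (ModuleCat.of R (Fin b → R)) := inferInstance
    obtain ⟨e', rfl⟩ := hses.exists_extClass_comp e
      (Ext.eq_zero_of_projective (P := ModuleCat.of R (Fin b → R)) _)
    rw [Ext.comp_assoc _ _ _ _ (add_zero r) (by omega)]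
    have h := Submodule.mem_map_of_mem
      (f := hses.shortExact.extClass.precompOfLinear R (ModuleCat.of R M) (add_comm 1 r)) (hn e')
    rw [Submodule.map_smul''] at h
    exact Submodule.smul_mono le_rfl le_top h

lemma Ext.exists_comp_mkQ_ne_zero [IsLocalRing R] {M : Type u} [AddCommGroup M] [Module R M]
    [Module.Finite R M] {r : ℕ}
    {e : Ext (ModuleCat.of R (R ⧸ maximalIdeal R)) (ModuleCat.of R M) r} (he : e ≠ 0) :
    ∃ n : ℕ, e.comp (Ext.mk₀ (ModuleCat.ofHom
      (maximalIdeal R ^ n • (⊤ : Submodule R M)).mkQ)) (add_zero r) ≠ 0 := by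
  obtain ⟨n, hn⟩ := Ext.exists_mem_smul_top (X := R ⧸ maximalIdeal R) (M := M) (maximalIdeal R) r
  refine ⟨n, fun h => he ?_⟩
  have hses : LinearMap.IsSES (maximalIdeal R ^ n • (⊤ : Submodule R M)).subtype
      (maximalIdeal R ^ n • (⊤ : Submodule R M)).mkQ :=
    ⟨Subtype.val_injective, LinearMap.exact_subtype_mkQ _, Submodule.mkQ_surjective _⟩
  obtain ⟨e', he'⟩ := Ext.covariant_sequence_exact₂ _ hses.shortExact e h
  have h1 := hn e'
  have h2 : e'.comp (Ext.mk₀ (ModuleCat.ofHom (Submodule.subtype _))) (add_zero r) = e := he'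
  rw [h2] at h1
  suffices maximalIdeal R • (⊤ : Submodule R (Ext (ModuleCat.of R (R ⧸ maximalIdeal R))
      (ModuleCat.of R M) r)) ≤ ⊥ from (Submodule.mem_bot R).1 (this h1)
  refine Submodule.smul_le.2 fun x hx y _ => (Submodule.mem_bot R).2 ?_
  have hx0 : x • (LinearMap.id : (R ⧸ maximalIdeal R) →ₗ[R] _) = (0 : R) • LinearMap.id := by
    refine residue_hom_ext ?_
    simpa using smul_residue_hom_one LinearMap.id hx
  rw [← Ext.pull_smul_id, hx0, Ext.pull_smul_id, zero_smul]

end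

section

variable {R : Type u} [CommRing R]

lemma Ext.pull_injective_of_surjective {A B : Type u} [AddCommGroup A] [Module R A]
    [AddCommGroup B] [Module R B] {Y : ModuleCat.{u} R} {f : A →ₗ[R] B}
    (hf : Function.Surjective f) {e : Ext (ModuleCat.of R B) Y 0} (he : Ext.pull f e = 0) :
    e = 0 := by
  obtain ⟨φ, rfl⟩ := (Ext.mk₀_bijective _ _).2 e
  rw [Ext.pull, Ext.mk₀_comp_mk₀, Ext.mk₀_eq_zero_iff] at he
  rw [Ext.mk₀_eq_zero_iff]
  ext b
  obtain ⟨a, rfl⟩ := hf b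
  exact ConcreteCategory.congr_hom he a

lemma LinearMap.IsSES.mapQ {A B C : Type u} [AddCommGroup A] [Module R A] [AddCommGroup B]
    [Module R B] [AddCommGroup C] [Module R C] {f : A →ₗ[R] B} {g : B →ₗ[R] C}
    (h : LinearMap.IsSES f g) (Q : Submodule R B) :
    LinearMap.IsSES ((Q.comap f).mapQ Q f le_rfl)
      (Q.mapQ (Q.map g) g (Submodule.le_comap_map g Q)) where
  inj := by
    refine LinearMap.ker_eq_bot.1 (eq_bot_iff.2 fun x hx => ?_)
    obtain ⟨a, rfl⟩ := Submodule.Quotient.mk_surjective _ x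
    exact (Submodule.Quotient.mk_eq_zero _).2 ((Submodule.Quotient.mk_eq_zero Q).1 hx)
  exact := by
    intro y
    obtain ⟨b, rfl⟩ := Submodule.Quotient.mk_surjective _ y
    constructor
    · intro hb
      obtain ⟨q, hq, hqb⟩ := (Submodule.Quotient.mk_eq_zero (Q.map g)).1 hb
      obtain ⟨a, ha⟩ := (h.exact (b - q)).1 (by rw [map_sub, hqb, sub_self])
      refine ⟨Submodule.Quotient.mk a, (Submodule.Quotient.eq Q).2 ?_⟩
      rw [ha, sub_sub_cancel_left]
      exact Q.neg_mem hq
    · rintro ⟨x, hx⟩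
      obtain ⟨a, rfl⟩ := Submodule.Quotient.mk_surjective _ x
      rw [← hx]
      change Submodule.Quotient.mk (g (f a)) = _
      rw [h.exact.apply_apply_eq_zero]
      rfl
  surj := by
    intro y
    obtain ⟨c, rfl⟩ := Submodule.Quotient.mk_surjective _ y
    obtain ⟨b, rfl⟩ := h.surj c
    exact ⟨Submodule.Quotient.mk b, rfl⟩

variable [IsNoetherianRing R] [IsLocalRing R]

lemma ModuleCat.pull_mkQ_cosyzTors (M : ModuleCat.{u} R) {N : Type u} [AddCommGroup N]
    [Module R N] {m : ℕ} (hN : ∀ x ∈ maximalIdeal R, ∀ b : N, x ^ m • b = 0) {i j : ℕ}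
    (hij : i ≤ j) (e : Ext (ModuleCat.of R (M.cosyz (j + 1) ⧸ M.cosyzTors j))
      (ModuleCat.of R N) i) : Ext.pull (M.cosyzTors j).mkQ e = 0 := by
  let Γ := fun j => powTors (M.cosyz j).envelope (maximalIdeal R : Set R)
  have hses := fun j => (M.isSES_cosyz j).mapQ (Γ j)
  induction i generalizing j with
  | zero =>
    have he : e = 0 := Ext.pull_injective_of_surjective (hses j).surj
      ((Ext.subsingleton_quotient_powTors (maximalIdeal R) hN 0).elim _ 0)
    rw [he, Ext.pull_zero]
  | succ i ih =>
    obtain ⟨j, rfl⟩ : ∃ j', j = j' + 1 := ⟨j - 1, by omega⟩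
    obtain ⟨e', rfl⟩ := (hses (j + 1)).exists_extClass_comp e
      ((Ext.subsingleton_quotient_powTors (maximalIdeal R) hN (i + 1)).elim _ 0)
    have hle : M.cosyzTors j ≤ (Γ (j + 1)).comap (M.cosyz (j + 1)).toEnvelope := by
      rintro _ ⟨c, hc, rfl⟩
      exact powTors_map_mem _ (powTors_map_mem _ hc)
    have h0 : Ext.pull ((Γ (j + 1)).comap (M.cosyz (j + 1)).toEnvelope).mkQ e' = 0 := by
      rw [← ih (by omega) (Ext.pull (Submodule.factor hle) e'), Ext.pull_pull]
      rfl
    let α : ModuleCat.shortComplexOfCompEqZero _ _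
          (M.isSES_cosyz (j + 1)).exact.linearMap_comp_eq_zero ⟶
        ModuleCat.shortComplexOfCompEqZero _ _ (hses (j + 1)).exact.linearMap_comp_eq_zero :=
      { τ₁ := ModuleCat.ofHom (Submodule.mkQ _)
        τ₂ := ModuleCat.ofHom (Submodule.mkQ _)
        τ₃ := ModuleCat.ofHom (Submodule.mkQ _) }
    have hα := ShortComplex.ShortExact.extClass_naturality
      (M.isSES_cosyz (j + 1)).shortExact (hses (j + 1)).shortExact α
    have h1 : Ext.pull (M.cosyzTors (j + 1)).mkQ (hses (j + 1)).shortExact.extClass =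
        (M.isSES_cosyz (j + 1)).shortExact.extClass.comp
          (Ext.mk₀ (ModuleCat.ofHom (Submodule.mkQ _))) (add_zero 1) := hα.symm
    exact (Ext.pull_comp _ (hses (j + 1)).shortExact.extClass e' (add_comm 1 i)).trans <|
      (congrArg (fun z => Ext.comp z e' (add_comm 1 i)) h1).trans <|
      (Ext.comp_assoc _ _ _ _ (zero_add i) (by omega)).trans <|
      (congrArg (fun z => (M.isSES_cosyz (j + 1)).shortExact.extClass.comp z (add_comm 1 i))
        h0).trans (Ext.comp_zero ..)

lemma ModuleCat.pull_comp_mkQ_eq_zero {M : Type u} [AddCommGroup M] [Module R M] {r w n : ℕ}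
    (hrw : r ≤ w + 1)
    (hr : Subsingleton (Ext (ModuleCat.of R (R ⧸ maximalIdeal R)) (ModuleCat.of R M) (r + 1)))
    {ξ : (R ⧸ maximalIdeal R) →ₗ[R] (ModuleCat.of R M).cosyz (w + 2)}
    (hξ : ξ (Submodule.Quotient.mk 1) ∉ (ModuleCat.of R M).cosyzTors (w + 1))
    (e : Ext (ModuleCat.of R (R ⧸ maximalIdeal R)) (ModuleCat.of R M) r) :
    e.comp (Ext.mk₀ (ModuleCat.ofHom
      (maximalIdeal R ^ n • (⊤ : Submodule R M)).mkQ)) (add_zero r) = 0 := by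
  let Z := (ModuleCat.of R M).cosyz (w + 2)
  let E := Z.envelope
  let B : Submodule R Z := (ModuleCat.of R M).cosyzTors (w + 1)
  let Γ := powTors E (maximalIdeal R : Set R)
  let D := B.map Z.toEnvelope
  have hDΓ : D ≤ Γ := by
    rintro _ ⟨_, ⟨c, hc, rfl⟩, rfl⟩
    exact powTors_map_mem _ (powTors_map_mem _ hc)
  let W := LinearMap.ker (Submodule.factor hDΓ)
  have hW : powTors W (maximalIdeal R : Set R) = ⊤ := by
    refine eq_top_iff.2 ?_
    rintro ⟨x, hx⟩ -
    refine powTors_mem_of_injective W.injective_subtype ?_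
    obtain ⟨a, rfl⟩ := Submodule.Quotient.mk_surjective _ x
    exact powTors_map_mem D.mkQ ((Submodule.Quotient.mk_eq_zero Γ).1 hx)
  have hN : ∀ x ∈ maximalIdeal R,
      ∀ b : M ⧸ (maximalIdeal R ^ n • (⊤ : Submodule R M)), x ^ n • b = 0 := fun x hx b => by
    obtain ⟨a, rfl⟩ := Submodule.Quotient.mk_surjective _ b
    rw [← Submodule.Quotient.mk_smul]
    exact (Submodule.Quotient.mk_eq_zero _).2
      (Submodule.smul_mem_smul (Ideal.pow_mem_pow hx n) trivial)
  let ρ : (Z ⧸ B) →ₗ[R] E ⧸ D := B.mapQ D Z.toEnvelope (Submodule.le_comap_map _ _)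
  let θ : (R ⧸ maximalIdeal R) →ₗ[R] W := (ρ ∘ₗ B.mkQ ∘ₗ ξ).codRestrict W fun a => by
    refine (Submodule.Quotient.mk_eq_zero Γ).2 fun x hx => ⟨1, ?_⟩
    obtain ⟨s, rfl⟩ := Submodule.Quotient.mk_surjective _ a
    change x ^ 1 • Z.toEnvelope (ξ (Submodule.Quotient.mk s)) = 0
    rw [pow_one, ← map_smul, ← map_smul, ← Submodule.Quotient.mk_smul, smul_eq_mul,
      (Submodule.Quotient.mk_eq_zero (maximalIdeal R)).2 (Ideal.mul_mem_right _ _ hx), map_zero,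
      map_zero]
  have hθ : Function.Injective θ := by
    refine residue_hom_injective fun h => hξ ?_
    obtain ⟨b, hb, hbξ⟩ := (Submodule.Quotient.mk_eq_zero D).1 (congrArg Subtype.val h)
    exact Z.toEnvelope_injective hbξ ▸ hb
  have hWθ : powTors (W ⧸ LinearMap.range θ) (maximalIdeal R : Set R) = ⊤ := by
    refine eq_top_iff.2 fun x _ => ?_
    obtain ⟨a, rfl⟩ := Submodule.mkQ_surjective _ x
    exact powTors_map_mem _ (hW.ge trivial)
  obtain ⟨e₁, rfl⟩ := (LinearMap.isSES_range hθ).exists_pull_left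
    (Ext.subsingleton_of_powTors hWθ r _ hr) e
  obtain ⟨e₂, he₂⟩ := (LinearMap.isSES_ker (Submodule.factor_surjective hDΓ)).exists_pull_left
    (Ext.subsingleton_quotient_powTors (maximalIdeal R) hN (r + 1))
    (e₁.comp (Ext.mk₀ (ModuleCat.ofHom
      (maximalIdeal R ^ n • (⊤ : Submodule R M)).mkQ)) (add_zero r))
  rw [← Ext.pull_comp, ← he₂, Ext.pull_pull]
  have hcomp : (LinearMap.ker (Submodule.factor hDΓ)).subtype ∘ₗ θ = ρ ∘ₗ B.mkQ ∘ₗ ξ := rfl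
  rw [hcomp, ← Ext.pull_pull, ← Ext.pull_pull]
  exact (congrArg (Ext.pull ξ) (ModuleCat.pull_mkQ_cosyzTors _ hN hrw _)).trans
    (Ext.pull_zero ξ)

/-- Over a Noetherian local ring, the nonzero `Ext` modules from the residue field to a finitely
generated module occur in consecutive degrees. -/
lemma Ext.subsingleton_residueField_of_le {M : Type u} [AddCommGroup M] [Module R M]
    [Module.Finite R M] {s t : ℕ} (hst : s ≤ t)
    (hs : ¬ Subsingleton (Ext (ModuleCat.of R (R ⧸ maximalIdeal R)) (ModuleCat.of R M) s))
    (ht : Subsingleton (Ext (ModuleCat.of R (R ⧸ maximalIdeal R)) (ModuleCat.of R M) t))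
    {u : ℕ} (hu : t ≤ u) :
    Subsingleton (Ext (ModuleCat.of R (R ⧸ maximalIdeal R)) (ModuleCat.of R M) u) := by
  obtain ⟨r, hrt, hr, hr'⟩ : ∃ r < t,
      ¬ Subsingleton (Ext (ModuleCat.of R (R ⧸ maximalIdeal R)) (ModuleCat.of R M) r) ∧
      Subsingleton (Ext (ModuleCat.of R (R ⧸ maximalIdeal R)) (ModuleCat.of R M) (r + 1)) := by
    by_contra! hcon
    have : ∀ v, s ≤ v → v ≤ t →
        ¬ Subsingleton (Ext (ModuleCat.of R (R ⧸ maximalIdeal R)) (ModuleCat.of R M) v) := by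
      intro v hv
      induction v, hv using Nat.le_induction with
      | base => exact fun _ => hs
      | succ v _ ih =>
        exact fun hvt => not_subsingleton_iff_nontrivial.2
          (hcon v hvt (not_subsingleton_iff_nontrivial.1 (ih (by omega))))
    exact this t hst le_rfl ht
  induction u, hu using Nat.le_induction with
  | base => exact ht
  | succ u hu ih =>
    obtain ⟨w, rfl⟩ : ∃ w, u = w + 1 := ⟨u - 1, by omega⟩
    refine subsingleton_of_forall_eq 0 fun e => ?_
    by_contra he
    obtain ⟨ξ, rfl⟩ := (ModuleCat.of R M).exists_pull_cosyzClass e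
    have hξ := ModuleCat.notMem_cosyzTors _ ih he
    obtain ⟨η, hη⟩ : ∃ η : Ext (ModuleCat.of R (R ⧸ maximalIdeal R)) (ModuleCat.of R M) r,
        η ≠ 0 := by
      by_contra! hcon
      exact hr (subsingleton_of_forall_eq 0 hcon)
    obtain ⟨n, hn⟩ := Ext.exists_comp_mkQ_ne_zero hη
    exact hn (ModuleCat.pull_comp_mkQ_eq_zero (by omega) hr' hξ η)

end

end

/-- Over a Noetherian local ring `(R, 𝔪, k)`, let `N` be a Burch submodule of a
finitely generated module `X` with `depth_R N > 0` (i.e. `𝔪` contains an `N`-regular element),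
and let `M` be finitely generated. If there is an integer `t ≥ 1` with `t ≥ depth_R M` such that
`Ext^t_R(N, M) = Ext^{t-1}_R(N, M) = 0`, then `M` has finite injective dimension. -/
theorem burch_ext_vanishing_finite_injective_dimension
    {R : Type u} [CommRing R] [IsNoetherianRing R] [IsLocalRing R]
    {X : Type u} [AddCommGroup X] [Module R X] [Module.Finite R X]
    (N : Submodule R X) (hN : N.IsBurch)
    (hdepthN : ∃ r ∈ IsLocalRing.maximalIdeal R, IsSMulRegular (↥N) r)
    {M : Type u} [AddCommGroup M] [Module R M] [Module.Finite R M]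
    (t : ℕ) (ht : 1 ≤ t) (htdepth : moduleDepth R M ≤ (t : ℕ∞))
    (h1 : ExtIsZero R (↥N) M t) (h2 : ExtIsZero R (↥N) M (t - 1)) :
    ∃ n : ℕ, HasInjDimLT R M n := by
  obtain ⟨t, rfl⟩ : ∃ t', t = t' + 1 := ⟨t - 1, by omega⟩
  rw [Nat.add_sub_cancel] at h2
  have hk := hN.subsingleton_ext_residueField hdepthN ((extIsZero_iff _).1 h1)
    ((extIsZero_iff _).1 h2)
  obtain ⟨_, ⟨s, rfl, hs⟩, hst⟩ := sInf_lt_iff.1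
    (htdepth.trans_lt (Nat.cast_lt.2 (Nat.lt_succ_self (t + 1))))
  rw [extIsZero_iff] at hs
  exact ⟨_, exists_hasInjDimLT_of_subsingleton_ext (t := t + 1)
    (Ext.subsingleton_of_residueField fun i hi =>
      Ext.subsingleton_residueField_of_le (Nat.lt_succ_iff.1 (Nat.cast_lt.1 hst)) hs hk hi)⟩
end

section
/- Let (R,m,k) be a commutative Noetherian local ring that is not regular. If N is a finitely generated R-module of finite projective dimension, or of finite injective dimension, then N is not isomorphic to a Burch submodule of any finitely generated R-module. -/
open CategoryTheory

universe u

/-- A minimal free resolution of a module `M` over a local ring, presented by its syzygies `Z n`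
and the short exact sequences `0 → Z (n + 1) → R ^ r n → Z n → 0`. -/
structure MinimalFreeResolution (R : Type u) [CommRing R] [IsLocalRing R]
    (M : Type u) [AddCommGroup M] [Module R M] where
  r : ℕ → ℕ
  Z : ℕ → ModuleCat.{u} R
  f : ∀ n, (Fin (r n) → R) →ₗ[R] Z n
  ι : ∀ n, Z (n + 1) →ₗ[R] (Fin (r n) → R)
  surj : ∀ n, Function.Surjective (f n)
  inj : ∀ n, Function.Injective (ι n)
  exact : ∀ n, Function.Exact (ι n) (f n)
  minimal : ∀ n z i, ι n z i ∈ IsLocalRing.maximalIdeal R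
  zeroEquiv : Z 0 ≃ₗ[R] M

/-- A finitely generated module over a local ring has a free cover whose kernel has entries in the
maximal ideal. -/
theorem exists_minimal_cover {R : Type u} [CommRing R] [IsLocalRing R]
    (M : Type u) [AddCommGroup M] [Module R M] [Module.Finite R M] :
    ∃ (r : ℕ) (f : (Fin r → R) →ₗ[R] M), Function.Surjective f ∧
      ∀ v ∈ LinearMap.ker f, ∀ i, v i ∈ IsLocalRing.maximalIdeal R := by
  classical
  have hex : ∃ r : ℕ, ∃ g : Fin r → M, Submodule.span R (Set.range g) = ⊤ :=
    Module.Finite.exists_fin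
  obtain ⟨g, hg⟩ := Nat.find_spec hex
  have hmin : ∀ s < Nat.find hex, ¬ ∃ g : Fin s → M, Submodule.span R (Set.range g) = ⊤ :=
    fun s hs => Nat.find_min hex hs
  generalize Nat.find hex = r at g hg hmin
  refine ⟨r, Fintype.linearCombination R g, ?_, ?_⟩
  · rw [← LinearMap.range_eq_top, Fintype.range_linearCombination, hg]
  · intro v hv i
    by_contra hi
    have hu : IsUnit (v i) := by simpa using hi
    obtain _ | r := r
    · exact i.elim0
    refine hmin r (Nat.lt_succ_self r) ⟨fun j => g (i.succAbove j), ?_⟩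
    rw [eq_top_iff, ← hg, Submodule.span_le]
    have hmem : g i ∈ Submodule.span R (Set.range fun j => g (i.succAbove j)) := by
      have h0 : v i • g i + ∑ j, v (i.succAbove j) • g (i.succAbove j) = 0 := by
        rw [← Fin.sum_univ_succAbove (fun j => v j • g j) i]
        simpa [Fintype.linearCombination_apply] using hv
      rw [← Submodule.smul_mem_iff_of_isUnit _ hu, eq_neg_of_add_eq_zero_left h0]
      exact Submodule.neg_mem _ (Submodule.sum_mem _ fun j _ =>
        Submodule.smul_mem _ _ (Submodule.subset_span ⟨j, rfl⟩))
    rintro _ ⟨j, rfl⟩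
    by_cases hj : j = i
    · exact hj ▸ hmem
    · obtain ⟨k, rfl⟩ := Fin.exists_succAbove_eq hj
      exact Submodule.subset_span ⟨k, rfl⟩

theorem exists_minimalFreeResolution {R : Type u} [CommRing R] [IsNoetherianRing R]
    [IsLocalRing R] (M : Type u) [AddCommGroup M] [Module R M] [Module.Finite R M] :
    Nonempty (MinimalFreeResolution R M) := by
  choose r f hs hm using fun A : {A : ModuleCat.{u} R // Module.Finite R A} =>
    haveI := A.2
    exists_minimal_cover (R := R) A.1
  let syz : {A : ModuleCat.{u} R // Module.Finite R A} →
      {A : ModuleCat.{u} R // Module.Finite R A} := fun A =>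
    ⟨ModuleCat.of R (LinearMap.ker (f A)), by dsimp; infer_instance⟩
  let Z : ℕ → {A : ModuleCat.{u} R // Module.Finite R A} := fun n =>
    Nat.rec ⟨ModuleCat.of R M, by dsimp; infer_instance⟩ (fun _ A => syz A) n
  exact ⟨{
    r := fun n => r (Z n)
    Z := fun n => (Z n).1
    f := fun n => f (Z n)
    ι := fun n => (LinearMap.ker (f (Z n))).subtype
    surj := fun n => hs (Z n)
    inj := fun n => Subtype.val_injective
    exact := fun n => LinearMap.exact_subtype_ker_map _
    minimal := fun n z i => hm (Z n) z.1 z.2 i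
    zeroEquiv := LinearEquiv.refl R M }⟩

/-- A linear map from a free module of finite rank lifts along a linear map whose range contains
its image. -/
theorem exists_lift_of_forall_exists {R : Type u} [CommRing R] {r : ℕ} {A B : Type u}
    [AddCommGroup A] [Module R A] [AddCommGroup B] [Module R B] (g : A →ₗ[R] B)
    (h : (Fin r → R) →ₗ[R] B) (hgh : ∀ v, ∃ a, g a = h v) :
    ∃ l : (Fin r → R) →ₗ[R] A, ∀ v, g (l v) = h v := by
  choose a ha using fun i : Fin r => hgh (Pi.single i 1)
  refine ⟨(Pi.basisFun R (Fin r)).constr R a, ?_⟩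
  have : g ∘ₗ (Pi.basisFun R (Fin r)).constr R a = h := by
    refine (Pi.basisFun R (Fin r)).ext fun i => ?_
    rw [LinearMap.comp_apply, Module.Basis.constr_basis, ha, Pi.basisFun_apply]
  exact fun v => LinearMap.congr_fun this v

namespace MinimalFreeResolution

variable {R : Type u} [CommRing R] [IsLocalRing R] {M : Type u} [AddCommGroup M] [Module R M]
  (F : MinimalFreeResolution R M)

theorem f_ι (n : ℕ) (z : F.Z (n + 1)) : F.f n (F.ι n z) = 0 := (F.exact n).apply_apply_eq_zero z

/-- If `y` annihilates `M`, then multiplication by `y` is null-homotopic on a resolution of `M`. -/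
theorem exists_homotopy {y : R} (hy : ∀ x : M, y • x = 0) (n : ℕ) :
    ∃ h : (Fin (F.r n) → R) →ₗ[R] F.Z (n + 1), ∀ z, h (F.ι n z) = y • z := by
  induction n with
  | zero =>
    obtain ⟨h, hh⟩ := exists_lift_of_forall_exists (F.ι 0) (y • LinearMap.id) (fun v => by
      refine (F.exact 0 _).1 (F.zeroEquiv.injective ?_)
      simp [hy])
    refine ⟨h, fun z => F.inj 0 ?_⟩
    rw [hh]
    simp
  | succ n ih =>
    obtain ⟨h, hh⟩ := ih
    obtain ⟨g, hg⟩ := exists_lift_of_forall_exists (F.f (n + 1)) h (fun v => F.surj (n + 1) _)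
    obtain ⟨l, hl⟩ := exists_lift_of_forall_exists (F.ι (n + 1))
      (y • LinearMap.id - g ∘ₗ F.ι n ∘ₗ F.f (n + 1)) (fun v => by
        refine (F.exact (n + 1) _).1 ?_
        simp [hg, hh])
    refine ⟨l, fun z => F.inj (n + 1) ?_⟩
    rw [hl]
    simp [f_ι]

/-- If two consecutive differentials of a minimal free resolution of a module killed by `y` have
entries in an ideal not containing `y`, then the resolution vanishes there. -/
theorem isEmpty_of_entries_mem {y : R} (hy : ∀ x : M, y • x = 0) {b : Ideal R} (hyb : y ∉ b)
    (n : ℕ) (h0 : ∀ z i, F.ι n z i ∈ b) (h1 : ∀ z i, F.ι (n + 1) z i ∈ b) :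
    IsEmpty (Fin (F.r (n + 1))) := by
  refine ⟨fun i => hyb ?_⟩
  obtain ⟨h, hh⟩ := F.exists_homotopy hy n
  obtain ⟨g, hg⟩ := exists_lift_of_forall_exists (F.f (n + 1)) h (fun v => F.surj (n + 1) _)
  let v : Fin (F.r (n + 1)) → R := Pi.single i 1
  obtain ⟨w, hw⟩ := (F.exact (n + 1) (y • v - g (F.ι n (F.f (n + 1) v)))).1
    (by simp [hg, hh])
  have hgb : g (F.ι n (F.f (n + 1) v)) i ∈ b := by
    rw [LinearMap.pi_apply_eq_sum_univ g, Finset.sum_apply]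
    exact Ideal.sum_mem _ fun j _ => Ideal.mul_mem_right _ _ (h0 _ j)
  have := b.add_mem (h1 w i) hgb
  rw [hw] at this
  simpa [v] using this

/-- The complex of free modules underlying `F`. -/
noncomputable def complex : ChainComplex (ModuleCat.{u} R) ℕ :=
  ChainComplex.of (fun n => ModuleCat.of R (Fin (F.r n) → R))
    (fun n => ModuleCat.ofHom (F.ι n ∘ₗ F.f (n + 1))) (fun n => by
      ext : 1
      refine LinearMap.ext fun v => ?_
      simp [f_ι])

theorem complex_d (n : ℕ) :
    F.complex.d (n + 1) n = ModuleCat.ofHom (F.ι n ∘ₗ F.f (n + 1)) := by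
  simp [complex]

/-- The projection of `F` onto `M`. -/
noncomputable def augmentation : F.complex.X 0 ⟶ ModuleCat.of R M :=
  ModuleCat.ofHom (F.zeroEquiv.toLinearMap ∘ₗ F.f 0)

theorem complex_d_comp_augmentation : F.complex.d 1 0 ≫ F.augmentation = 0 := by
  rw [complex_d]
  ext : 1
  refine LinearMap.ext fun v => ?_
  change F.zeroEquiv (F.f 0 (F.ι 0 (F.f 1 v))) = 0
  rw [f_ι, map_zero]

theorem exact_augmentation :
    (ShortComplex.mk _ _ F.complex_d_comp_augmentation).Exact := by
  rw [ShortComplex.moduleCat_exact_iff]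
  intro x hx
  obtain ⟨z, hz⟩ := (F.exact 0 x).1 (F.zeroEquiv.injective (hx.trans (map_zero _).symm))
  obtain ⟨w, rfl⟩ := F.surj 1 z
  refine ⟨w, ?_⟩
  change F.complex.d 1 0 w = x
  rw [complex_d]
  exact hz

theorem complex_exactAt_succ (n : ℕ) : F.complex.ExactAt (n + 1) := by
  rw [HomologicalComplex.exactAt_iff' _ (n + 1 + 1) (n + 1) n (by simp) (by simp),
    ShortComplex.moduleCat_exact_iff]
  intro x hx
  have hx' : F.ι n (F.f (n + 1) x) = 0 := by
    have hx2 : F.complex.d (n + 1) n x = 0 := hx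
    rwa [complex_d] at hx2
  obtain ⟨z, hz⟩ := (F.exact (n + 1) x).1 (F.inj n (hx'.trans (map_zero _).symm))
  obtain ⟨w, rfl⟩ := F.surj (n + 2) z
  refine ⟨w, ?_⟩
  change F.complex.d (n + 2) (n + 1) w = x
  rw [complex_d]
  exact hz

/-- The projective resolution underlying a minimal free resolution. -/
noncomputable def projectiveResolution : ProjectiveResolution (ModuleCat.of R M) where
  complex := F.complex
  projective n := (IsProjective.iff_projective (R := R) (Fin (F.r n) → R)).1 inferInstance
  π := (ChainComplex.toSingle₀Equiv _ _).symm ⟨F.augmentation, F.complex_d_comp_augmentation⟩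
  quasiIso := ⟨fun n => by
    cases n
    · rw [ChainComplex.quasiIsoAt₀_iff, ShortComplex.quasiIso_iff_of_zeros']
      · refine (ShortComplex.exact_and_epi_g_iff_of_iso ?_).2
          ⟨F.exact_augmentation, (ModuleCat.epi_iff_surjective _).2
            (F.zeroEquiv.surjective.comp (F.surj 0))⟩
        exact ShortComplex.isoMk (Iso.refl _) (Iso.refl _) (Iso.refl _)
          ((Category.id_comp _).trans (Category.comp_id _).symm)
          ((Category.id_comp _).trans (Category.comp_id _).symm)
      all_goals rfl
    · rw [quasiIsoAt_iff_exactAt']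
      · apply complex_exactAt_succ
      · apply ChainComplex.exactAt_succ_single_obj⟩

theorem hasProjDimLT {t : ℕ} (ht : ∀ n, t ≤ n → IsEmpty (Fin (F.r n))) : HasProjDimLT R M t :=
  ⟨F.projectiveResolution, fun n hn =>
    have := ht n hn
    ModuleCat.isZero_of_subsingleton (ModuleCat.of R (Fin (F.r n) → R))⟩

/-- Every map from the `(s + 1)`-st syzygy to `A` extends to the free module containing it, that
is, the first `Ext` module of the `s`-th syzygy with values in `A` vanishes. -/
def ExtendsAt (A : Type u) [AddCommGroup A] [Module R A] (s : ℕ) : Prop :=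
  ∀ g : F.Z (s + 1) →ₗ[R] A, ∃ h : (Fin (F.r s) → R) →ₗ[R] A, ∀ z, h (F.ι s z) = g z

/-- The first `Tor` module of `A` and the `s`-th syzygy vanishes. -/
def TensorInjectiveAt (A : Type u) [AddCommGroup A] [Module R A] (s : ℕ) : Prop :=
  Function.Injective ((F.ι s).lTensor A)

theorem ExtendsAt.succ {A I A' : Type u} [AddCommGroup A] [Module R A] [AddCommGroup I]
    [Module R I] [AddCommGroup A'] [Module R A'] [Module.Injective R I]
    {i : A →ₗ[R] I} {p : I →ₗ[R] A'} (hi : Function.Injective i) (hip : Function.Exact i p)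
    (hp : Function.Surjective p) {s : ℕ} (h : F.ExtendsAt A' s) : F.ExtendsAt A (s + 1) := by
  intro g
  obtain ⟨k, hk⟩ := Module.Injective.out (F.ι (s + 1)) (F.inj _) (i ∘ₗ g)
  have hker : LinearMap.ker (F.f (s + 1)) ≤ LinearMap.ker (p ∘ₗ k) := by
    intro v hv
    obtain ⟨z, rfl⟩ := (F.exact (s + 1) v).1 hv
    simp only [LinearMap.mem_ker, LinearMap.comp_apply, hk]
    exact hip.apply_apply_eq_zero _
  obtain ⟨q, hq⟩ : ∃ q : F.Z (s + 1) →ₗ[R] A', ∀ v, q (F.f (s + 1) v) = p (k v) := by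
    let e := (F.f (s + 1)).quotKerEquivOfSurjective (F.surj _)
    refine ⟨(LinearMap.ker (F.f (s + 1))).liftQ (p ∘ₗ k) hker ∘ₗ e.symm.toLinearMap, fun v => ?_⟩
    have : e.symm (F.f (s + 1) v) = Submodule.Quotient.mk v := by
      rw [LinearEquiv.symm_apply_eq]; rfl
    simp [this]
  obtain ⟨l, hl⟩ := h q
  obtain ⟨m, hm⟩ := exists_lift_of_forall_exists p l (fun v => hp _)
  obtain ⟨n, hn⟩ := exists_lift_of_forall_exists i (k - m ∘ₗ F.ι s ∘ₗ F.f (s + 1)) (fun v => by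
    refine (hip _).1 ?_
    simp [hm, hl, hq])
  refine ⟨n, fun z => hi ?_⟩
  rw [hn]
  simp [f_ι, hk]

theorem TensorInjectiveAt.succ {A P A' : Type u} [AddCommGroup A] [Module R A] [AddCommGroup P]
    [Module R P] [AddCommGroup A'] [Module R A'] [Module.Flat R P]
    {i : A' →ₗ[R] P} {p : P →ₗ[R] A} (hi : Function.Injective i) (hip : Function.Exact i p)
    (hp : Function.Surjective p) {s : ℕ} (h : F.TensorInjectiveAt A' s) :
    F.TensorInjectiveAt A (s + 1) := by
  have comm : ∀ {B C D E : Type u} [AddCommGroup B] [Module R B] [AddCommGroup C] [Module R C]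
      [AddCommGroup D] [Module R D] [AddCommGroup E] [Module R E] (a : B →ₗ[R] C) (c : D →ₗ[R] E)
      (x : TensorProduct R B D), a.rTensor E (c.lTensor B x) = c.lTensor C (a.rTensor D x) := by
    intro B C D E _ _ _ _ _ _ _ _ a c x
    rw [← LinearMap.comp_apply, ← LinearMap.comp_apply, LinearMap.rTensor_comp_lTensor,
      LinearMap.lTensor_comp_rTensor]
  have hinj : Function.Injective (i.rTensor (F.Z (s + 1))) := by
    refine Function.Injective.of_comp (f := (F.ι s).lTensor P) ?_
    have : (F.ι s).lTensor P ∘ i.rTensor (F.Z (s + 1)) =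
        i.rTensor (Fin (F.r s) → R) ∘ (F.ι s).lTensor A' := by
      funext x
      exact (comm i (F.ι s) x).symm
    rw [this]
    exact (Module.Flat.rTensor_preserves_injective_linearMap i hi).comp h
  refine (injective_iff_map_eq_zero _).2 fun z hz => ?_
  obtain ⟨z, rfl⟩ := LinearMap.rTensor_surjective _ hp z
  rw [← comm] at hz
  obtain ⟨w, hw⟩ := (rTensor_exact _ hip hp _).1 hz
  have hw0 : (F.f (s + 1)).lTensor A' w = 0 := by
    refine hinj ?_
    rw [comm, hw, map_zero]
    exact (lTensor_exact P (F.exact (s + 1)) (F.surj _)).apply_apply_eq_zero z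
  obtain ⟨w, rfl⟩ := (lTensor_exact A' (F.exact (s + 1)) (F.surj _) _).1 hw0
  have : z = i.rTensor _ w := by
    refine Module.Flat.lTensor_preserves_injective_linearMap (F.ι (s + 1)) (F.inj _) ?_
    rw [← hw, comm]
  rw [this]
  exact (rTensor_exact _ hip hp).apply_apply_eq_zero w

theorem ExtendsAt.entries {N : Type u} [AddCommGroup N] [Module R N]
    (φ : IsLocalRing.maximalIdeal R →ₗ[R] N) {s : ℕ} (h : F.ExtendsAt N s)
    (z : F.Z (s + 1)) (i : Fin (F.r s)) :
    φ ⟨F.ι s z i, F.minimal s z i⟩ ∈ IsLocalRing.maximalIdeal R • (⊤ : Submodule R N) := by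
  obtain ⟨ψ, hψ⟩ := h (φ ∘ₗ (LinearMap.proj i ∘ₗ F.ι s).codRestrict _
    (fun z => F.minimal s z i))
  have := hψ z
  rw [LinearMap.pi_apply_eq_sum_univ ψ] at this
  have h2 : φ ⟨F.ι s z i, F.minimal s z i⟩ = _ := this.symm
  rw [h2]
  exact Submodule.sum_mem _ fun j _ => Submodule.smul_mem_smul (F.minimal s z j) trivial

theorem TensorInjectiveAt.entries {N : Type u} [AddCommGroup N] [Module R N]
    (φ : IsLocalRing.maximalIdeal R →ₗ[R] N) {s : ℕ} (h : F.TensorInjectiveAt N s)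
    (z : F.Z (s + 2)) (i : Fin (F.r (s + 1))) :
    φ ⟨F.ι (s + 1) z i, F.minimal (s + 1) z i⟩ ∈
      IsLocalRing.maximalIdeal R • (⊤ : Submodule R N) := by
  classical
  let e : Fin (F.r (s + 1)) → Fin (F.r (s + 1)) → R := fun j => Pi.single j 1
  let a : Fin (F.r (s + 1)) → IsLocalRing.maximalIdeal R := fun j =>
    ⟨F.ι (s + 1) z j, F.minimal (s + 1) z j⟩
  let E : TensorProduct R N (Fin (F.r (s + 1)) → R) := ∑ j, φ (a j) ⊗ₜ[R] e j
  have hE : (F.f (s + 1)).lTensor N E = 0 := by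
    refine h ((TensorProduct.piScalarRight R R N (Fin (F.r s))).injective ?_)
    ext l
    have hsum : ∑ j, F.ι s (F.f (s + 1) (e j)) l • a j = 0 := by
      refine Subtype.ext ?_
      have := LinearMap.pi_apply_eq_sum_univ (F.ι s ∘ₗ F.f (s + 1)) (F.ι (s + 1) z)
      simp only [LinearMap.comp_apply, f_ι, map_zero] at this
      have h3 := (congrFun this l).symm
      simp only [Finset.sum_apply, Pi.smul_apply, Pi.zero_apply, smul_eq_mul] at h3
      have h4 : ∀ j, e j = fun i => if j = i then 1 else 0 := fun j => by
        ext i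
        simp [e, Pi.single_apply, eq_comm]
      simpa [a, h4, mul_comm] using h3
    have := congrArg φ hsum
    simpa [E, TensorProduct.piScalarRight_apply] using this
  obtain ⟨w, hw⟩ := (lTensor_exact N (F.exact (s + 1)) (F.surj _) _).1 hE
  have hmem : ∀ w : TensorProduct R N (F.Z (s + 2)),
      TensorProduct.piScalarRight R R N _ ((F.ι (s + 1)).lTensor N w) i ∈
        IsLocalRing.maximalIdeal R • (⊤ : Submodule R N) := by
    intro w
    induction w using TensorProduct.induction_on with
    | zero => simp
    | tmul n x =>
      simpa [TensorProduct.piScalarRight_apply] using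
        Submodule.smul_mem_smul (F.minimal (s + 1) x i) (Submodule.mem_top (x := n))
    | add x y hx hy => simpa using Submodule.add_mem _ hx hy
  have := hmem w
  rw [hw] at this
  simpa [E, e, a, TensorProduct.piScalarRight_apply, Pi.single_apply] using this

theorem tensorInjectiveAt_of_subsingleton (A : Type u) [AddCommGroup A] [Module R A]
    [Subsingleton A] (s : ℕ) : F.TensorInjectiveAt A s :=
  Function.injective_of_subsingleton _

theorem extendsAt_of_subsingleton (A : Type u) [AddCommGroup A] [Module R A]
    [Subsingleton A] (s : ℕ) : F.ExtendsAt A s :=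
  fun _ => ⟨0, fun _ => Subsingleton.elim _ _⟩

theorem tensorInjectiveAt_of_hasProjDimLT {N : Type u} [AddCommGroup N] [Module R N] {t : ℕ}
    (h : HasProjDimLT R N t) {s : ℕ} (hs : t ≤ s) : F.TensorInjectiveAt N s := by
  obtain ⟨P, hP⟩ := h
  have flat : ∀ n, Module.Flat R (P.complex.X n) := fun n =>
    have : Module.Projective R (P.complex.X n) :=
      (IsProjective.iff_projective _).2 (P.projective n)
    inferInstance
  have key : ∀ i j, t ≤ j + 1 + i → ∀ s, i ≤ s →
      F.TensorInjectiveAt (LinearMap.range (P.complex.d (j + 1) j).hom) s := by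
    intro i
    induction i with
    | zero =>
      intro j hj s _
      have : Subsingleton (P.complex.X (j + 1)) :=
        ModuleCat.subsingleton_of_isZero (hP _ hj)
      have : Subsingleton (LinearMap.range (P.complex.d (j + 1) j).hom) :=
        (LinearMap.surjective_rangeRestrict (P.complex.d (j + 1) j).hom).subsingleton
      exact F.tensorInjectiveAt_of_subsingleton _ s
    | succ i ih =>
      intro j hj s hs
      obtain ⟨s, rfl⟩ := Nat.exists_eq_succ_of_ne_zero (by omega : s ≠ 0)
      have := flat (j + 1)
      refine TensorInjectiveAt.succ F (Submodule.injective_subtype _) ?_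
        (LinearMap.surjective_rangeRestrict (P.complex.d (j + 1) j).hom)
        (ih (j + 1) (by omega) s (by omega))
      have hex := (ShortComplex.moduleCat_exact_iff_range_eq_ker _).1 (P.exact_succ j)
      rw [LinearMap.exact_iff, Submodule.range_subtype, LinearMap.ker_rangeRestrict]
      exact hex.symm
  obtain _ | t := t
  · have : Subsingleton (P.complex.X 0) := ModuleCat.subsingleton_of_isZero (hP _ le_rfl)
    have : Subsingleton N :=
      ((ModuleCat.epi_iff_surjective (P.π.f 0)).1 inferInstance).subsingleton
    exact F.tensorInjectiveAt_of_subsingleton _ s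
  · obtain ⟨s, rfl⟩ := Nat.exists_eq_succ_of_ne_zero (by omega : s ≠ 0)
    have := flat 0
    refine TensorInjectiveAt.succ F (p := (P.π.f 0).hom) (Submodule.injective_subtype _) ?_
      ((ModuleCat.epi_iff_surjective (P.π.f 0)).1 inferInstance)
      (key t 0 (by omega) s (by omega))
    have hex := (ShortComplex.moduleCat_exact_iff_range_eq_ker _).1 P.exact₀
    rw [LinearMap.exact_iff, Submodule.range_subtype]
    exact hex.symm

theorem extendsAt_of_hasInjDimLT {N : Type u} [AddCommGroup N] [Module R N] {t : ℕ}
    (h : HasInjDimLT R N t) {s : ℕ} (hs : t ≤ s) : F.ExtendsAt N s := by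
  obtain ⟨I, hI⟩ := h
  have inj : ∀ n, Module.Injective R (I.cocomplex.X n) := fun n =>
    have := I.injective n
    Module.injective_module_of_injective_object R _
  have key : ∀ i j, t ≤ j + 1 + i → ∀ s, i ≤ s →
      F.ExtendsAt (LinearMap.range (I.cocomplex.d j (j + 1)).hom) s := by
    intro i
    induction i with
    | zero =>
      intro j hj s _
      have : Subsingleton (I.cocomplex.X (j + 1)) :=
        ModuleCat.subsingleton_of_isZero (hI _ hj)
      exact F.extendsAt_of_subsingleton _ s
    | succ i ih =>
      intro j hj s hs
      obtain ⟨s, rfl⟩ := Nat.exists_eq_succ_of_ne_zero (by omega : s ≠ 0)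
      have := inj (j + 1)
      refine ExtendsAt.succ F (Submodule.injective_subtype _) ?_
        (LinearMap.surjective_rangeRestrict (I.cocomplex.d (j + 1) (j + 2)).hom)
        (ih (j + 1) (by omega) s (by omega))
      have hex := (ShortComplex.moduleCat_exact_iff_range_eq_ker _).1 (I.exact_succ j)
      rw [LinearMap.exact_iff, Submodule.range_subtype, LinearMap.ker_rangeRestrict]
      exact hex.symm
  have hι : Function.Injective (I.ι.f 0).hom :=
    (ModuleCat.mono_iff_injective (I.ι.f 0)).1 inferInstance
  obtain _ | t := t
  · have : Subsingleton (I.cocomplex.X 0) := ModuleCat.subsingleton_of_isZero (hI _ le_rfl)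
    have : Subsingleton N := hι.subsingleton
    exact F.extendsAt_of_subsingleton _ s
  · obtain ⟨s, rfl⟩ := Nat.exists_eq_succ_of_ne_zero (by omega : s ≠ 0)
    have := inj 0
    refine ExtendsAt.succ F (i := (I.ι.f 0).hom) hι ?_
      (LinearMap.surjective_rangeRestrict (I.cocomplex.d 0 1).hom)
      (key t 0 (by omega) s (by omega))
    have hex := (ShortComplex.moduleCat_exact_iff_range_eq_ker _).1 I.exact₀
    rw [LinearMap.exact_iff, LinearMap.ker_rangeRestrict]
    exact hex.symm

end MinimalFreeResolution

/-- A Burch submodule `K` receives a linear map from the maximal ideal whose image is not contained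
in `𝔪 • K`. -/
theorem Submodule.IsBurch.exists_linearMap {R X : Type u} [CommRing R] [IsLocalRing R]
    [AddCommGroup X] [Module R X] {K : Submodule R X} (hK : K.IsBurch) :
    ∃ (φ : IsLocalRing.maximalIdeal R →ₗ[R] K) (y : IsLocalRing.maximalIdeal R),
      φ y ∉ IsLocalRing.maximalIdeal R • (⊤ : Submodule R K) := by
  by_contra! hφ
  refine hK (le_antisymm (Submodule.smul_le.2 fun y hy x hx => ?_)
    (Submodule.smul_mono le_rfl fun x hx r _ => K.smul_mem r hx))
  have := Submodule.mem_map_of_mem (f := K.subtype) (hφ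
    (((LinearMap.toSpanSingleton R X x).domRestrict (IsLocalRing.maximalIdeal R)).codRestrict K
      fun r => hx r r.2) ⟨y, hy⟩)
  rw [Submodule.map_smul'', Submodule.map_subtype_top] at this
  exact this

/-- If the entries of all but finitely many differentials in a minimal free resolution of the
residue field are sent into `𝔪 • N` by a linear map `𝔪 → N`, and this map does not itself have image
in `𝔪 • N`, then the residue field has finite projective dimension. -/
theorem MinimalFreeResolution.exists_hasProjDimLT_residueField {R : Type u} [CommRing R]
    [IsLocalRing R] (F : MinimalFreeResolution R (IsLocalRing.ResidueField R))
    {N : Type u} [AddCommGroup N] [Module R N] (φ : IsLocalRing.maximalIdeal R →ₗ[R] N)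
    {y : IsLocalRing.maximalIdeal R}
    (hy : φ y ∉ IsLocalRing.maximalIdeal R • (⊤ : Submodule R N)) {t : ℕ}
    (ht : ∀ s, t ≤ s → ∀ z i, φ ⟨F.ι s z i, F.minimal s z i⟩ ∈
      IsLocalRing.maximalIdeal R • (⊤ : Submodule R N)) :
    ∃ n, HasProjDimLT R (IsLocalRing.ResidueField R) n := by
  let b : Ideal R := ((IsLocalRing.maximalIdeal R • (⊤ : Submodule R N)).comap φ).map
    (IsLocalRing.maximalIdeal R).subtype
  have hb : ∀ s, t ≤ s → ∀ z i, F.ι s z i ∈ b := fun s hs z i => ⟨_, ht s hs z i, rfl⟩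
  have hyb : (y : R) ∉ b := by
    rintro ⟨a, ha, hay⟩
    exact hy (Subtype.ext hay ▸ ha)
  have hyk : ∀ x : IsLocalRing.ResidueField R, (y : R) • x = 0 := fun x => by
    rw [Algebra.smul_def, IsLocalRing.ResidueField.algebraMap_eq,
      (IsLocalRing.residue_eq_zero_iff _).2 y.2, zero_mul]
  refine ⟨t + 1, F.hasProjDimLT fun n hn => ?_⟩
  obtain ⟨n, rfl⟩ := Nat.exists_eq_succ_of_ne_zero (by omega : n ≠ 0)
  exact F.isEmpty_of_entries_mem hyk hyb n (hb n (by omega)) (hb (n + 1) (by omega))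

/-- Let `(R, 𝔪, k)` be a Noetherian local ring which is not regular (i.e. the
residue field `k` does not have finite projective dimension over `R`). If `N` is a finitely
generated `R`-module of finite projective dimension or of finite injective dimension, then `N`
is not isomorphic to a Burch submodule of any finitely generated `R`-module. -/
theorem finite_homological_dimension_not_burch
    {R : Type u} [CommRing R] [IsNoetherianRing R] [IsLocalRing R]
    (hsing : ¬ ∃ n : ℕ, HasProjDimLT R (IsLocalRing.ResidueField R) n)
    {N : Type u} [AddCommGroup N] [Module R N] [Module.Finite R N]
    (hfin : (∃ n : ℕ, HasProjDimLT R N n) ∨ (∃ n : ℕ, HasInjDimLT R N n)) :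
    ¬ ∃ (X : Type u) (_ : AddCommGroup X) (_ : Module R X) (_ : Module.Finite R X)
        (K : Submodule R X), K.IsBurch ∧ Nonempty (N ≃ₗ[R] ↥K) := by
  rintro ⟨X, _, _, _, K, hK, ⟨e⟩⟩
  obtain ⟨φ, y, hy⟩ := hK.exists_linearMap
  obtain ⟨F⟩ := exists_minimalFreeResolution (R := R) (IsLocalRing.ResidueField R)
  let ψ := e.symm.toLinearMap ∘ₗ φ
  have hψ : ψ y ∉ IsLocalRing.maximalIdeal R • (⊤ : Submodule R N) := fun h => hy (by
    have := Submodule.mem_map_of_mem (f := e.toLinearMap) h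
    rw [Submodule.map_smul'', Submodule.map_top, LinearEquiv.range] at this
    simpa [ψ] using this)
  refine hsing ?_
  obtain ⟨n, hn⟩ | ⟨n, hn⟩ := hfin
  · refine F.exists_hasProjDimLT_residueField ψ hψ (t := n + 1) fun s hs z i => ?_
    obtain ⟨s, rfl⟩ := Nat.exists_eq_succ_of_ne_zero (by omega : s ≠ 0)
    exact (F.tensorInjectiveAt_of_hasProjDimLT hn (by omega)).entries F ψ z i
  · exact F.exists_hasProjDimLT_residueField ψ hψ (t := n) fun s hs z i =>
      (F.extendsAt_of_hasInjDimLT hn hs).entries F ψ z i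
end
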